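/- Let χ₁ be a real-valued, even, nonprincipal, primitive Dirichlet character modulo N > 1, and let ρ > 1 be real. Then, as the real variable x → ∞, (1/Γ(ρ+1)) Σ_{n ≤ x} (x² − n²)^ρ 𝒟(n) = (√π x^{1+2ρ}/(4Γ(ρ+3/2))) · [ 2 L'(1, χ₁) + L(1, χ₁) ( Γ'(1/2)/√π − Γ'(ρ+3/2)/Γ(ρ+3/2) + 2 log x + 4γ ) ] + O(x^{(5ρ+1)/3}), where γ is the Euler–Mascheroni constant, Γ' is the derivative of the Gamma function, and L'(1,χ₁) the derivative of the L-function at s = 1. -/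

import Mathlib

open scoped Real Classical
open Filter Asymptotics

/-- `d_χ(n) = ∑_{k ∣ n} χ(k)`. -/
noncomputable def divisorSumChar {N : ℕ} (χ : DirichletCharacter ℂ N) (n : ℕ) : ℂ :=
  ∑ k ∈ n.divisors, χ (k : ZMod N)

/-- `𝒟(n) = ∑_{k ∣ n} d_{χ₁}(k)`. -/
noncomputable def scrD {N : ℕ} (χ₁ : DirichletCharacter ℂ N) (n : ℕ) : ℂ :=
  ∑ k ∈ n.divisors, divisorSumChar χ₁ k

/-- First derivative test for an oscillatory integral with monotone amplitude. -/
theorem norm_integral_le_of_first_derivative {a b M : ℝ} (hab : a ≤ b) {m m' θ θ' : ℝ → ℝ}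
    (hm : ∀ t ∈ Set.Icc a b, HasDerivAt m (m' t) t)
    (hθ : ∀ t ∈ Set.Icc a b, HasDerivAt θ (θ' t) t)
    (hmc : ContinuousOn m' (Set.Icc a b)) (hθc : ContinuousOn θ' (Set.Icc a b))
    (hsign : (∀ t ∈ Set.Icc a b, 0 ≤ m' t) ∨ (∀ t ∈ Set.Icc a b, m' t ≤ 0))
    (hM : ∀ t ∈ Set.Icc a b, |m t| ≤ M) :
    ‖∫ t in a..b, ((m t * θ' t : ℝ) : ℂ) * Complex.exp (θ t * Complex.I)‖ ≤ 4 * M := by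
  have hu : Set.uIcc a b = Set.Icc a b := Set.uIcc_of_le hab
  have hθcont : ContinuousOn θ (Set.Icc a b) := fun t ht => (hθ t ht).continuousAt.continuousWithinAt
  have hE : ∀ t ∈ Set.uIcc a b, HasDerivAt (fun t => -Complex.I * Complex.exp (θ t * Complex.I))
      ((θ' t : ℂ) * Complex.exp (θ t * Complex.I)) t := by
    intro t ht
    rw [hu] at ht
    have := ((((hθ t ht).ofReal_comp).mul_const Complex.I).cexp).const_mul (-Complex.I)
    refine this.congr_deriv ?_
    linear_combination (-(θ' t : ℂ) * Complex.exp (θ t * Complex.I)) * Complex.I_mul_I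
  have hmC : ∀ t ∈ Set.uIcc a b, HasDerivAt (fun t => (m t : ℂ)) (m' t : ℂ) t := by
    intro t ht
    rw [hu] at ht
    exact (hm t ht).ofReal_comp
  have hi1 : IntervalIntegrable (fun t => (m' t : ℂ)) MeasureTheory.volume a b := by
    apply ContinuousOn.intervalIntegrable
    rw [hu]
    exact Complex.continuous_ofReal.comp_continuousOn hmc
  have hi1r : IntervalIntegrable m' MeasureTheory.volume a b := by
    apply ContinuousOn.intervalIntegrable
    rwa [hu]
  have hi2 : IntervalIntegrable (fun t => (θ' t : ℂ) * Complex.exp (θ t * Complex.I))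
      MeasureTheory.volume a b := by
    apply ContinuousOn.intervalIntegrable
    rw [hu]
    exact (Complex.continuous_ofReal.comp_continuousOn hθc).mul
      (((Complex.continuous_ofReal.comp_continuousOn hθcont).mul continuousOn_const).cexp)
  have hparts := intervalIntegral.integral_mul_deriv_eq_deriv_mul hmC hE hi1 hi2
  have hne : ∀ t : ℝ, ‖-Complex.I * Complex.exp (θ t * Complex.I)‖ = 1 := by
    intro t
    rw [norm_mul, Complex.norm_exp_ofReal_mul_I]
    simp
  have hI : ‖∫ t in a..b, (m' t : ℂ) * (-Complex.I * Complex.exp (θ t * Complex.I))‖ ≤ 2 * M := by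
    have h1 : ‖∫ t in a..b, (m' t : ℂ) * (-Complex.I * Complex.exp (θ t * Complex.I))‖
        ≤ ∫ t in a..b, |m' t| := by
      refine (intervalIntegral.norm_integral_le_integral_norm hab).trans (le_of_eq ?_)
      congr 1
      ext t
      rw [norm_mul, hne]
      simp
    have h2 : ∫ t in a..b, m' t = m b - m a :=
      intervalIntegral.integral_eq_sub_of_hasDerivAt (fun t ht => hm t (hu ▸ ht)) hi1r
    have hMa := abs_le.mp (hM a ⟨le_rfl, hab⟩)
    have hMb := abs_le.mp (hM b ⟨hab, le_rfl⟩)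
    rcases hsign with h | h
    · have h3 : ∫ t in a..b, |m' t| = ∫ t in a..b, m' t :=
        intervalIntegral.integral_congr fun t ht => abs_of_nonneg (h t (hu ▸ ht))
      rw [h3, h2] at h1
      linarith
    · have h3 : ∫ t in a..b, |m' t| = ∫ t in a..b, -m' t :=
        intervalIntegral.integral_congr fun t ht => abs_of_nonpos (h t (hu ▸ ht))
      rw [h3, intervalIntegral.integral_neg, h2] at h1
      linarith
  have heq : (∫ t in a..b, ((m t * θ' t : ℝ) : ℂ) * Complex.exp (θ t * Complex.I))
      = ∫ t in a..b, (m t : ℂ) * ((θ' t : ℂ) * Complex.exp (θ t * Complex.I)) := by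
    congr 1
    ext t
    push_cast
    ring
  rw [heq, hparts]
  refine (norm_sub_le _ _).trans ?_
  have h4 := norm_sub_le ((m b : ℂ) * (-Complex.I * Complex.exp (θ b * Complex.I)))
    ((m a : ℂ) * (-Complex.I * Complex.exp (θ a * Complex.I)))
  rw [norm_mul (m b : ℂ), norm_mul (m a : ℂ), hne, hne, Complex.norm_real, Complex.norm_real,
    Real.norm_eq_abs, Real.norm_eq_abs] at h4
  have hMa := hM a ⟨le_rfl, hab⟩
  have hMb := hM b ⟨hab, le_rfl⟩
  linarith

/-- The phase `-6 (t log t - t - t log X)`, stationary at `t = X`. -/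
noncomputable def logPhase (X t : ℝ) : ℝ := -6 * (t * Real.log t - t - t * Real.log X)

theorem hasDerivAt_logPhase (X : ℝ) {t : ℝ} (ht : 0 < t) :
    HasDerivAt (logPhase X) (-6 * (Real.log t - Real.log X)) t := by
  have h1 := (((hasDerivAt_id t).mul (Real.hasDerivAt_log ht.ne')).sub (hasDerivAt_id t)).sub
    ((hasDerivAt_id t).mul_const (Real.log X))
  refine (h1.const_mul (-6)).congr_deriv ?_
  simp only [id]
  field_simp
  ring

theorem norm_integral_rpow_mul_exp_logPhase_le_of_ne {X u v M : ℝ} (hu : 0 < u)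
    (huv : u ≤ v) (hne : ∀ t ∈ Set.Icc u v, Real.log t - Real.log X ≠ 0)
    (hsign : (∀ t ∈ Set.Icc u v, -4 ≤ Real.log t - Real.log X) ∨
      (∀ t ∈ Set.Icc u v, Real.log t - Real.log X ≤ -4))
    (hM : ∀ t ∈ Set.Icc u v, t ^ (-(1 / 4) : ℝ) ≤ M * (6 * |Real.log t - Real.log X|)) :
    ‖∫ t in u..v, ((t ^ (-(1 / 4) : ℝ) : ℝ) : ℂ) * Complex.exp (logPhase X t * Complex.I)‖
      ≤ 4 * M := by
  have hpos : ∀ t ∈ Set.Icc u v, 0 < t := fun t ht => hu.trans_le ht.1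
  set m : ℝ → ℝ := fun t => t ^ (-(1 / 4) : ℝ) / (-6 * (Real.log t - Real.log X)) with hm
  set m' : ℝ → ℝ := fun t =>
    t ^ (-(1 / 4) - 1 : ℝ) * (6 + 3 / 2 * (Real.log t - Real.log X)) /
      (-6 * (Real.log t - Real.log X)) ^ 2 with hm'
  have hcl : ContinuousOn (fun t => Real.log t - Real.log X) (Set.Icc u v) :=
    (Real.continuousOn_log.mono fun t ht => (hpos t ht).ne').sub continuousOn_const
  have hder : ∀ t ∈ Set.Icc u v, HasDerivAt m (m' t) t := by
    intro t ht
    have ht0 := hpos t ht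
    have h1 := Real.hasDerivAt_rpow_const (p := (-(1 / 4) : ℝ)) (Or.inl ht0.ne')
    have h2 := ((Real.hasDerivAt_log ht0.ne').sub_const (Real.log X)).const_mul (-6)
    have hne' : (-6 * (Real.log t - Real.log X)) ≠ 0 := mul_ne_zero (by norm_num) (hne t ht)
    have h3 := h1.div h2 hne'
    refine h3.congr_deriv ?_
    simp only [hm']
    congr 1
    have : t ^ (-(1 / 4) : ℝ) = t ^ (-(1 / 4) - 1 : ℝ) * t := by
      rw [← Real.rpow_add_one ht0.ne']
      norm_num
    rw [this]
    field_simp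
    ring
  have key := norm_integral_le_of_first_derivative (M := M) huv hder
    (fun t ht => hasDerivAt_logPhase X (hpos t ht)) ?_ (continuousOn_const.mul hcl) ?_ ?_
  · convert key using 2
    apply intervalIntegral.integral_congr
    intro t ht
    rw [Set.uIcc_of_le huv] at ht
    simp only [hm]
    congr 2
    rw [div_mul_cancel₀]
    exact mul_ne_zero (by norm_num) (hne t ht)
  · apply ContinuousOn.div
    · apply ContinuousOn.mul
      · exact fun t ht => (Real.continuousAt_rpow_const t _ (Or.inl (hpos t ht).ne')).continuousWithinAt
      · exact continuousOn_const.add (continuousOn_const.mul hcl)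
    · exact (continuousOn_const.mul hcl).pow 2
    · intro t ht
      exact pow_ne_zero _ (mul_ne_zero (by norm_num) (hne t ht))
  · rcases hsign with h | h
    · left
      intro t ht
      have := h t ht
      have h0 := hpos t ht
      exact div_nonneg (mul_nonneg (by positivity) (by linarith)) (sq_nonneg _)
    · right
      intro t ht
      have := h t ht
      have h0 := hpos t ht
      exact div_nonpos_of_nonpos_of_nonneg
        (mul_nonpos_of_nonneg_of_nonpos (by positivity) (by linarith)) (sq_nonneg _)
  · intro t ht
    have h0 := hpos t ht
    have h1 := hM t ht
    have h2 : 0 < |Real.log t - Real.log X| := abs_pos.mpr (hne t ht)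
    simp only [hm]
    rw [abs_div, abs_mul, abs_of_pos (Real.rpow_pos_of_pos h0 _), div_le_iff₀ (by positivity)]
    norm_num
    norm_num at h1
    exact h1

/-- Stationary phase bound, uniform in the upper limit of integration. -/
theorem norm_integral_rpow_mul_exp_logPhase_le {X t₀ T : ℝ} (ht₀ : 1 ≤ t₀)
    (hX : Real.exp 4 * t₀ ≤ X) (hT : t₀ ≤ T) :
    ‖∫ t in t₀..T, ((t ^ (-(1 / 4) : ℝ) : ℝ) : ℂ) * Complex.exp (logPhase X t * Complex.I)‖
      ≤ 16 * X ^ (1 / 4 : ℝ) := by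
  have he4 : (16 : ℝ) ≤ Real.exp 4 := by
    have : (2 : ℝ) ≤ Real.exp 1 := by linarith [Real.add_one_le_exp 1]
    calc (16 : ℝ) = 2 ^ 4 := by norm_num
      _ ≤ Real.exp 1 ^ 4 := by gcongr
      _ = Real.exp 4 := by rw [← Real.exp_nat_mul]; norm_num
  have hX16 : 16 ≤ X := by nlinarith
  have hX0 : 0 < X := by linarith
  have hs : Real.sqrt X * Real.sqrt X = X := Real.mul_self_sqrt hX0.le
  have hs4 : 4 ≤ Real.sqrt X := by
    rw [Real.le_sqrt (by norm_num) hX0.le]; linarith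
  have hX4 : 1 ≤ X ^ (1 / 4 : ℝ) := Real.one_le_rpow (by linarith) (by norm_num)
  set R := X ^ (1 / 4 : ℝ) with hR
  have hRneg : X ^ (-(1 / 4) : ℝ) = R⁻¹ := by rw [Real.rpow_neg hX0.le]
  have hRs : R * R = Real.sqrt X := by
    rw [hR, ← Real.rpow_add hX0, Real.sqrt_eq_rpow]; norm_num
  set f : ℝ → ℂ := fun t => ((t ^ (-(1 / 4) : ℝ) : ℝ) : ℂ) * Complex.exp (logPhase X t * Complex.I)
    with hf
  have hfi : ∀ u v : ℝ, 0 < u → 0 < v → IntervalIntegrable f MeasureTheory.volume u v := by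
    intro u v hu hv
    apply ContinuousOn.intervalIntegrable
    have hp : ∀ t ∈ Set.uIcc u v, 0 < t := fun t ht => lt_of_lt_of_le (lt_min hu hv) ht.1
    intro t ht
    apply ContinuousAt.continuousWithinAt
    apply ContinuousAt.mul
    · exact Complex.continuous_ofReal.continuousAt.comp
        (Real.continuousAt_rpow_const t _ (Or.inl (hp t ht).ne'))
    · exact ((Complex.continuous_ofReal.continuousAt.comp
        (hasDerivAt_logPhase X (hp t ht)).continuousAt).mul continuousAt_const).cexp
  set p₁ := Real.exp (-4) * X with hp₁
  set p₂ := X - Real.sqrt X with hp₂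
  set p₃ := X + Real.sqrt X with hp₃
  have hp₁t : t₀ ≤ p₁ := by
    have : Real.exp (-4) * (Real.exp 4 * t₀) ≤ Real.exp (-4) * X := by gcongr
    rwa [← mul_assoc, ← Real.exp_add, neg_add_cancel, Real.exp_zero, one_mul] at this
  have hem4 : Real.exp (-4) ≤ 1 / 16 := by
    rw [Real.exp_neg, inv_eq_one_div]
    exact one_div_le_one_div_of_le (by norm_num) he4
  have hX2 : Real.sqrt X ≤ X / 4 := by nlinarith
  have hp₁₂ : p₁ ≤ p₂ := by nlinarith
  have hp₂₃ : p₂ ≤ p₃ := by linarith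
  have hlogp₁ : Real.log p₁ = -4 + Real.log X := by
    rw [hp₁, Real.log_mul (Real.exp_ne_zero _) hX0.ne', Real.log_exp]
  have hp₁pos : 0 < p₁ := by positivity
  have hp₂pos : 0 < p₂ := by linarith
  -- region far below the stationary point
  have r₁ : ∀ u v, t₀ ≤ u → u ≤ v → v ≤ p₁ → ‖∫ t in u..v, f t‖ ≤ 4 * R := by
    intro u v hu huv hv
    have hle : ∀ t ∈ Set.Icc u v, Real.log t - Real.log X ≤ -4 := by
      intro t ht
      have : Real.log t ≤ Real.log p₁ := Real.log_le_log (by linarith [ht.1]) (ht.2.trans hv)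
      linarith
    apply norm_integral_rpow_mul_exp_logPhase_le_of_ne (by linarith) huv
    · intro t ht
      have := hle t ht
      linarith
    · exact Or.inr hle
    · intro t ht
      have h1 := hle t ht
      rw [abs_of_nonpos (by linarith)]
      have : t ^ (-(1 / 4) : ℝ) ≤ 1 := Real.rpow_le_one_of_one_le_of_nonpos
        (by linarith [ht.1]) (by norm_num)
      nlinarith
  have hlow : ∀ t, p₁ ≤ t → t ^ (-(1 / 4) : ℝ) ≤ 3 * R⁻¹ := by
    intro t ht
    have h1 : t ^ (-(1 / 4) : ℝ) ≤ p₁ ^ (-(1 / 4) : ℝ) :=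
      Real.rpow_le_rpow_of_nonpos hp₁pos ht (by norm_num)
    refine h1.trans ?_
    rw [hp₁, Real.mul_rpow (Real.exp_pos _).le hX0.le, hRneg, ← Real.exp_mul]
    gcongr
    norm_num
    linarith [Real.exp_one_lt_d9]
  have hRi : R⁻¹ = R * (1 / Real.sqrt X) := by
    rw [← hRs]
    field_simp
  have r₂ : ∀ u v, p₁ ≤ u → u ≤ v → v ≤ p₂ → ‖∫ t in u..v, f t‖ ≤ 4 * R := by
    intro u v hu huv hv
    have hle : ∀ t ∈ Set.Icc u v, Real.log t - Real.log X ≤ -(1 / Real.sqrt X) := by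
      intro t ht
      have ht0 : 0 < t := by linarith [ht.1]
      rw [← Real.log_div ht0.ne' hX0.ne']
      have h1 := Real.log_le_sub_one_of_pos (div_pos ht0 hX0)
      have h2 : t / X ≤ 1 - 1 / Real.sqrt X := by
        rw [div_le_iff₀ hX0]
        have : (1 - 1 / Real.sqrt X) * X = X - Real.sqrt X := by
          have h3 : 1 / Real.sqrt X * X = Real.sqrt X := by
            rw [div_mul_eq_mul_div, one_mul, Real.div_sqrt]
          rw [sub_mul, one_mul, h3]
        rw [this]
        exact ht.2.trans hv
      linarith
    have hspos : 0 < 1 / Real.sqrt X := by positivity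
    apply norm_integral_rpow_mul_exp_logPhase_le_of_ne (by linarith) huv
    · intro t ht
      have := hle t ht
      linarith
    · left
      intro t ht
      have : Real.log p₁ ≤ Real.log t := Real.log_le_log hp₁pos (hu.trans ht.1)
      linarith
    · intro t ht
      have h1 := hle t ht
      rw [abs_of_nonpos (by linarith)]
      have h2 := hlow t (hu.trans ht.1)
      rw [hRi] at h2
      nlinarith
  have r₃ : ∀ u v, p₂ ≤ u → u ≤ v → v ≤ p₃ → ‖∫ t in u..v, f t‖ ≤ 4 * R := by
    intro u v hu huv hv
    have h1 : ‖∫ t in u..v, f t‖ ≤ (2 * R⁻¹) * |v - u| := by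
      apply intervalIntegral.norm_integral_le_of_norm_le_const
      intro t ht
      rw [Set.uIoc_of_le huv] at ht
      have ht2 : p₂ ≤ t := hu.trans ht.1.le
      have ht0 : 0 < t := by linarith
      simp only [hf]
      rw [norm_mul, Complex.norm_exp_ofReal_mul_I, mul_one, Complex.norm_real, Real.norm_eq_abs,
        abs_of_pos (Real.rpow_pos_of_pos ht0 _)]
      have h1 : t ^ (-(1 / 4) : ℝ) ≤ ((1 / 16) * X) ^ (-(1 / 4) : ℝ) :=
        Real.rpow_le_rpow_of_nonpos (by positivity) (by linarith) (by norm_num)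
      refine h1.trans (le_of_eq ?_)
      rw [Real.mul_rpow (by norm_num) hX0.le, hRneg]
      congr 1
      rw [show (1 / 16 : ℝ) = 2 ^ (-4 : ℝ) by norm_num, ← Real.rpow_mul (by norm_num)]
      norm_num
    refine h1.trans ?_
    rw [abs_of_nonneg (by linarith)]
    calc 2 * R⁻¹ * (v - u) ≤ 2 * R⁻¹ * (2 * Real.sqrt X) := by
          gcongr
          linarith
      _ = 4 * R := by
        rw [← hRs]
        field_simp
        norm_num
  have r₄ : ∀ u v, p₃ ≤ u → u ≤ v → ‖∫ t in u..v, f t‖ ≤ 4 * R := by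
    intro u v hu huv
    have hspos : 0 < 1 / (2 * Real.sqrt X) := by positivity
    have hge : ∀ t ∈ Set.Icc u v, 1 / (2 * Real.sqrt X) ≤ Real.log t - Real.log X := by
      intro t ht
      have ht0 : 0 < t := by linarith [ht.1]
      rw [← Real.log_div ht0.ne' hX0.ne']
      have h1 := Real.one_sub_inv_le_log_of_pos (div_pos ht0 hX0)
      have h2 : (t / X)⁻¹ ≤ 1 - 1 / (2 * Real.sqrt X) := by
        rw [inv_div, div_le_iff₀ ht0]
        have h3 : p₃ ≤ t := hu.trans ht.1
        have h5 : 1 / (2 * Real.sqrt X) ≤ 1 := by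
          rw [div_le_one (by positivity)]; linarith
        calc X ≤ (1 - 1 / (2 * Real.sqrt X)) * p₃ := by
              have : (1 - 1 / (2 * Real.sqrt X)) * p₃ = X + (Real.sqrt X - 1) / 2 := by
                have h6 : 1 / (2 * Real.sqrt X) * X = Real.sqrt X / 2 := by
                  rw [div_mul_eq_mul_div, one_mul, mul_comm 2, ← div_div, Real.div_sqrt]
                have h7 : 1 / (2 * Real.sqrt X) * Real.sqrt X = 1 / 2 := by field_simp
                rw [hp₃]
                linear_combination -h6 - h7
              rw [this]; linarith
          _ ≤ _ := by
              apply mul_le_mul_of_nonneg_left h3; linarith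
      linarith
    apply norm_integral_rpow_mul_exp_logPhase_le_of_ne (by linarith) huv
    · intro t ht
      have := hge t ht
      linarith
    · left
      intro t ht
      linarith [hge t ht]
    · intro t ht
      have h1 := hge t ht
      rw [abs_of_nonneg (by linarith)]
      have h2 := hlow t (by linarith [ht.1])
      rw [hRi] at h2
      have h3 : 1 / Real.sqrt X = 2 * (1 / (2 * Real.sqrt X)) := by field_simp
      rw [h3] at h2
      nlinarith
  have q₁ : t₀ ≤ min p₁ T := le_min hp₁t hT
  have q₂ : min p₁ T ≤ min p₂ T := min_le_min_right _ hp₁₂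
  have q₃ : min p₂ T ≤ min p₃ T := min_le_min_right _ hp₂₃
  have q₄ : min p₃ T ≤ T := min_le_right _ _
  have hz : ∀ u, ‖∫ t in u..u, f t‖ ≤ 4 * R := by
    intro u
    rw [intervalIntegral.integral_same, norm_zero]
    positivity
  have i₁ := r₁ _ _ le_rfl q₁ (min_le_left _ _)
  have i₂ : ‖∫ t in (min p₁ T)..(min p₂ T), f t‖ ≤ 4 * R := by
    by_cases h : T ≤ p₁
    · rw [min_eq_right h, min_eq_right (h.trans hp₁₂)]; exact hz _
    · rw [min_eq_left (le_of_not_ge h)] at q₂ ⊢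
      exact r₂ _ _ le_rfl q₂ (min_le_left _ _)
  have i₃ : ‖∫ t in (min p₂ T)..(min p₃ T), f t‖ ≤ 4 * R := by
    by_cases h : T ≤ p₂
    · rw [min_eq_right h, min_eq_right (h.trans hp₂₃)]; exact hz _
    · rw [min_eq_left (le_of_not_ge h)] at q₃ ⊢
      exact r₃ _ _ le_rfl q₃ (min_le_left _ _)
  have i₄ : ‖∫ t in (min p₃ T)..T, f t‖ ≤ 4 * R := by
    by_cases h : T ≤ p₃
    · rw [min_eq_right h]; exact hz _
    · rw [min_eq_left (le_of_not_ge h)] at q₄ ⊢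
      exact r₄ _ _ le_rfl q₄
  have t0p : 0 < t₀ := by linarith
  have e₁ := intervalIntegral.integral_add_adjacent_intervals
    (hfi t₀ (min p₁ T) t0p (by linarith)) (hfi (min p₁ T) (min p₂ T) (by linarith) (by linarith))
  have e₂ := intervalIntegral.integral_add_adjacent_intervals
    (hfi t₀ (min p₂ T) t0p (by linarith)) (hfi (min p₂ T) (min p₃ T) (by linarith) (by linarith))
  have e₃ := intervalIntegral.integral_add_adjacent_intervals
    (hfi t₀ (min p₃ T) t0p (by linarith)) (hfi (min p₃ T) T (by linarith) (by linarith))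
  rw [← e₃, ← e₂, ← e₁]
  refine (norm_add_le _ _).trans ?_
  have n1 := norm_add_le (∫ t in t₀..(min p₁ T), f t) (∫ t in (min p₁ T)..(min p₂ T), f t)
  have n2 := norm_add_le ((∫ t in t₀..(min p₁ T), f t) + ∫ t in (min p₁ T)..(min p₂ T), f t)
    (∫ t in (min p₂ T)..(min p₃ T), f t)
  linarith

/-- Abel summation for integrals: inserting the decreasing weight `exp (-ε t ^ 2)` does not worsen
a bound for the partial integrals. -/
theorem norm_integral_Ioi_mul_gaussian_le {f : ℝ → ℂ} (hf : Continuous f) {t₀ M ε : ℝ}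
    (ht₀ : 0 ≤ t₀) (hε : 0 < ε) (hM : ∀ T, t₀ ≤ T → ‖∫ t in t₀..T, f t‖ ≤ M)
    (hint : MeasureTheory.IntegrableOn (fun t => f t * (Real.exp (-ε * t ^ 2) : ℂ)) (Set.Ioi t₀)) :
    ‖∫ t in Set.Ioi t₀, f t * (Real.exp (-ε * t ^ 2) : ℂ)‖ ≤ M := by
  have hM0 : 0 ≤ M := (norm_nonneg _).trans (hM t₀ le_rfl)
  have htend := MeasureTheory.intervalIntegral_tendsto_integral_Ioi t₀ hint tendsto_id
  refine le_of_tendsto htend.norm ?_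
  filter_upwards [eventually_ge_atTop t₀] with T hT
  simp only [id]
  set w : ℝ → ℝ := fun t => Real.exp (-ε * t ^ 2) with hw
  set w' : ℝ → ℝ := fun t => Real.exp (-ε * t ^ 2) * (-ε * (2 * t)) with hw'
  have hwd : ∀ t, HasDerivAt w (w' t) t := by
    intro t
    have := ((hasDerivAt_pow 2 t).const_mul (-ε)).exp
    exact this.congr_deriv (by simp only [hw']; norm_num)
  have hJ : ∀ t ∈ Set.uIcc t₀ T, HasDerivAt (fun u => ∫ s in t₀..u, f s) (f t) t := fun t _ =>
    intervalIntegral.integral_hasDerivAt_right (hf.intervalIntegrable _ _)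
      (hf.stronglyMeasurableAtFilter _ _) hf.continuousAt
  have hw'c : Continuous w' := by rw [hw']; fun_prop
  have hparts := intervalIntegral.integral_mul_deriv_eq_deriv_mul
    (u := fun t => (w t : ℂ)) (u' := fun t => (w' t : ℂ))
    (fun t _ => (hwd t).ofReal_comp) hJ
    ((Complex.continuous_ofReal.comp hw'c).intervalIntegrable _ _) (hf.intervalIntegrable _ _)
  have heq : (∫ t in t₀..T, f t * (Real.exp (-ε * t ^ 2) : ℂ)) = ∫ t in t₀..T, (w t : ℂ) * f t := by
    congr 1; ext t; rw [mul_comm]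
  rw [heq, hparts, intervalIntegral.integral_same, mul_zero, sub_zero]
  refine (norm_sub_le _ _).trans ?_
  have h1 : ‖(w T : ℂ) * ∫ s in t₀..T, f s‖ ≤ w T * M := by
    rw [norm_mul, Complex.norm_real, Real.norm_of_nonneg (Real.exp_pos _).le]
    exact mul_le_mul_of_nonneg_left (hM T hT) (Real.exp_pos _).le
  have h2 : ‖∫ t in t₀..T, (w' t : ℂ) * ∫ s in t₀..t, f s‖ ≤ ∫ t in t₀..T, (-w' t) * M := by
    apply intervalIntegral.norm_integral_le_of_norm_le hT
    · refine Eventually.of_forall fun t ht => ?_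
      rw [norm_mul, Complex.norm_real, Real.norm_eq_abs]
      have hneg : w' t ≤ 0 := by
        simp only [hw']
        have : 0 < t := ht₀.trans_lt ht.1
        have h3 : 0 < Real.exp (-ε * t ^ 2) := Real.exp_pos _
        nlinarith [mul_pos hε this]
      rw [abs_of_nonpos hneg]
      exact mul_le_mul_of_nonneg_left (hM t ht.1.le) (by linarith)
    · exact (hw'c.neg.mul continuous_const).intervalIntegrable _ _
  rw [intervalIntegral.integral_mul_const, intervalIntegral.integral_neg,
    intervalIntegral.integral_eq_sub_of_hasDerivAt (fun t _ => hwd t)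
      (hw'c.intervalIntegrable _ _)] at h2
  have h3 : w t₀ ≤ 1 := by
    simp only [hw]
    rw [Real.exp_le_one_iff]
    nlinarith [sq_nonneg t₀]
  nlinarith

open ComplexConjugate in
theorem exists_norm_le_of_asymptotic {k : ℝ → ℂ} (hk : Continuous k)
    (hconj : ∀ t, k (-t) = conj (k t)) {A : ℂ} {C t₀ : ℝ} (ht₀ : 1 ≤ t₀)
    (h : ∀ t, t₀ ≤ t → ‖k t - A * (((t ^ (-(1 / 4) : ℝ) : ℝ) : ℂ) *
      Complex.exp (((-6 * (t * Real.log t - t) : ℝ) : ℂ) * Complex.I))‖ ≤ C * t ^ (-(5 / 4) : ℝ)) :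
    ∃ B, ∀ t, ‖k t‖ ≤ B := by
  obtain ⟨B, hB⟩ := (isCompact_Icc (a := (0 : ℝ)) (b := t₀)).exists_bound_of_continuousOn
    hk.continuousOn
  have hC : 0 ≤ C := by
    have := (norm_nonneg _).trans (h t₀ le_rfl)
    exact nonneg_of_mul_nonneg_left this (Real.rpow_pos_of_pos (by linarith) _)
  have hpos : ∀ t, 0 ≤ t → ‖k t‖ ≤ max B (C + ‖A‖) := by
    intro t ht
    by_cases htt : t ≤ t₀
    · exact (hB t ⟨ht, htt⟩).trans (le_max_left _ _)
    · push Not at htt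
      have h1 : 1 ≤ t := by linarith
      have h2 := h t htt.le
      have h3 := norm_le_norm_add_norm_sub' (k t) (A * (((t ^ (-(1 / 4) : ℝ) : ℝ) : ℂ) *
        Complex.exp (((-6 * (t * Real.log t - t) : ℝ) : ℂ) * Complex.I)))
      rw [norm_mul, norm_mul, Complex.norm_exp_ofReal_mul_I, Complex.norm_real, mul_one,
        Real.norm_of_nonneg (Real.rpow_nonneg ht _)] at h3
      have h4 : t ^ (-(1 / 4) : ℝ) ≤ 1 := Real.rpow_le_one_of_one_le_of_nonpos h1 (by norm_num)
      have h5 : t ^ (-(5 / 4) : ℝ) ≤ 1 := Real.rpow_le_one_of_one_le_of_nonpos h1 (by norm_num)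
      have h6 := mul_le_mul_of_nonneg_left h4 (norm_nonneg A)
      have h7 := mul_le_mul_of_nonneg_left h5 hC
      refine le_trans ?_ (le_max_right _ _)
      linarith
  refine ⟨max B (C + ‖A‖), fun t => ?_⟩
  rcases le_total 0 t with ht | ht
  · exact hpos t ht
  · have := hpos (-t) (by linarith)
    rwa [hconj, Complex.norm_conj] at this

theorem integrable_mul_gaussian {g : ℝ → ℂ} (hg : Continuous g) {B : ℝ} (hB : ∀ t, ‖g t‖ ≤ B)
    {ε : ℝ} (hε : 0 < ε) :
    MeasureTheory.Integrable (fun t => g t * (Real.exp (-ε * t ^ 2) : ℂ)) := by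
  have h1 : MeasureTheory.Integrable (fun t : ℝ => (Real.exp (-ε * t ^ 2) : ℂ)) :=
    (integrable_exp_neg_mul_sq hε).ofReal
  exact h1.bdd_mul hg.aestronglyMeasurable (Eventually.of_forall hB)

open ComplexConjugate in
/-- Uniform bound for a regularized Mellin-Barnes integral whose kernel has cubic phase. -/
theorem exists_norm_integral_kernel_le {k : ℝ → ℂ} (hk : Continuous k)
    (hconj : ∀ t, k (-t) = conj (k t)) {A : ℂ} {C t₀ : ℝ} (ht₀ : 1 ≤ t₀)
    (h : ∀ t, t₀ ≤ t → ‖k t - A * (((t ^ (-(1 / 4) : ℝ) : ℝ) : ℂ) *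
      Complex.exp (((-6 * (t * Real.log t - t) : ℝ) : ℂ) * Complex.I))‖ ≤ C * t ^ (-(5 / 4) : ℝ)) :
    ∃ M X₀ : ℝ, 1 ≤ X₀ ∧ 0 ≤ M ∧ ∀ X, X₀ ≤ X → ∀ ε, 0 < ε →
      ‖∫ t : ℝ, k t * Complex.exp (((6 * t * Real.log X : ℝ) : ℂ) * Complex.I) *
        (Real.exp (-ε * t ^ 2) : ℂ)‖ ≤ M * X ^ (1 / 4 : ℝ) := by
  obtain ⟨B, hB⟩ := exists_norm_le_of_asymptotic hk hconj ht₀ h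
  have hB0 : 0 ≤ B := (norm_nonneg _).trans (hB 0)
  have hC : 0 ≤ C := by
    have := (norm_nonneg _).trans (h t₀ le_rfl)
    exact nonneg_of_mul_nonneg_left this (Real.rpow_pos_of_pos (by linarith) _)
  refine ⟨2 * (B * t₀ + ‖A‖ * 16 + 4 * C), Real.exp 4 * t₀, ?_, by positivity, ?_⟩
  · nlinarith [Real.add_one_le_exp 4]
  intro X hX ε hε
  have hX1 : 1 ≤ X := by nlinarith [Real.add_one_le_exp 4]
  have hXr : 1 ≤ X ^ (1 / 4 : ℝ) := Real.one_le_rpow hX1 (by norm_num)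
  set g : ℝ → ℂ := fun t => k t * Complex.exp (((6 * t * Real.log X : ℝ) : ℂ) * Complex.I) with hg
  have hgc : Continuous g := by rw [hg]; fun_prop
  have hgB : ∀ t, ‖g t‖ ≤ B := by
    intro t
    simp only [hg]
    rw [norm_mul, Complex.norm_exp_ofReal_mul_I, mul_one]
    exact hB t
  have hint := integrable_mul_gaussian hgc hgB hε
  have hw1 : ∀ t : ℝ, ‖(Real.exp (-ε * t ^ 2) : ℂ)‖ ≤ 1 := by
    intro t
    rw [Complex.norm_real, Real.norm_of_nonneg (Real.exp_pos _).le, Real.exp_le_one_iff]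
    nlinarith [sq_nonneg t]
  set G : ℝ → ℂ := fun t => g t * (Real.exp (-ε * t ^ 2) : ℂ) with hG
  change ‖∫ t, G t‖ ≤ _
  have hGneg : ∀ t, G (-t) = conj (G t) := by
    intro t
    simp only [hG, hg, map_mul, hconj, ← Complex.exp_conj, Complex.conj_I, Complex.conj_ofReal]
    congr 3
    · push_cast; ring
    · ring
  have hsplit : ∫ t, G t = conj (∫ t in Set.Ioi 0, G t) + ∫ t in Set.Ioi 0, G t := by
    rw [← intervalIntegral.integral_Iic_add_Ioi (b := 0) hint.integrableOn hint.integrableOn]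
    congr 1
    rw [← integral_conj, ← neg_zero, ← integral_comp_neg_Ioi (0 : ℝ) G]
    simp only [hGneg, neg_zero]
  have hhalf : ‖∫ t in Set.Ioi 0, G t‖ ≤ (B * t₀ + ‖A‖ * 16 + 4 * C) * X ^ (1 / 4 : ℝ) := by
    rw [← intervalIntegral.integral_interval_add_Ioi' (b := t₀) (hint.intervalIntegrable)
      hint.integrableOn]
    have hlow : ‖∫ t in (0 : ℝ)..t₀, G t‖ ≤ B * t₀ := by
      have := intervalIntegral.norm_integral_le_of_norm_le_const (a := 0) (b := t₀) (C := B)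
        (f := G) fun t _ => by
          simp only [hG]
          rw [norm_mul]
          calc _ ≤ B * 1 := mul_le_mul (hgB t) (hw1 t) (norm_nonneg _) hB0
            _ = B := mul_one _
      rwa [sub_zero, abs_of_nonneg (by linarith)] at this
    set F : ℝ → ℂ := fun t => (((max t t₀) ^ (-(1 / 4) : ℝ) : ℝ) : ℂ) *
      Complex.exp (logPhase X (max t t₀) * Complex.I) with hF
    have hFc : Continuous F := by
      have hmax : Continuous fun t : ℝ => max t t₀ := by fun_prop
      have hpos : ∀ t : ℝ, 0 < max t t₀ := fun t => lt_of_lt_of_le (by linarith) (le_max_right _ _)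
      rw [continuous_iff_continuousAt]
      intro t
      apply ContinuousAt.mul
      · exact Complex.continuous_ofReal.continuousAt.comp
          (hmax.continuousAt.rpow_const (Or.inl (hpos t).ne'))
      · exact ((Complex.continuous_ofReal.continuousAt.comp
          ((hasDerivAt_logPhase X (hpos t)).continuousAt.comp (f := fun t : ℝ => max t t₀)
            hmax.continuousAt)).mul
            continuousAt_const).cexp
    have hFB : ∀ t, ‖F t‖ ≤ 1 := by
      intro t
      simp only [hF]
      have h1 : 1 ≤ max t t₀ := ht₀.trans (le_max_right _ _)
      rw [norm_mul, Complex.norm_exp_ofReal_mul_I, Complex.norm_real, mul_one,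
        Real.norm_of_nonneg (Real.rpow_nonneg (by linarith) _)]
      exact Real.rpow_le_one_of_one_le_of_nonpos h1 (by norm_num)
    have hFint := integrable_mul_gaussian hFc hFB hε
    have hFpart : ∀ T, t₀ ≤ T → ‖∫ t in t₀..T, F t‖ ≤ 16 * X ^ (1 / 4 : ℝ) := by
      intro T hT
      have : ∫ t in t₀..T, F t = ∫ t in t₀..T, ((t ^ (-(1 / 4) : ℝ) : ℝ) : ℂ) *
          Complex.exp (logPhase X t * Complex.I) := by
        apply intervalIntegral.integral_congr
        intro t ht
        rw [Set.uIcc_of_le hT] at ht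
        simp only [hF, max_eq_left ht.1]
      rw [this]
      exact norm_integral_rpow_mul_exp_logPhase_le ht₀ hX hT
    have hmain := norm_integral_Ioi_mul_gaussian_le hFc (by linarith) hε hFpart hFint.integrableOn
    have hdecomp : ∫ t in Set.Ioi t₀, G t =
        A * (∫ t in Set.Ioi t₀, F t * (Real.exp (-ε * t ^ 2) : ℂ)) +
          ∫ t in Set.Ioi t₀, (G t - A * (F t * (Real.exp (-ε * t ^ 2) : ℂ))) := by
      rw [← MeasureTheory.integral_const_mul, ← MeasureTheory.integral_add]
      · congr 1; ext t; ring
      · exact (hFint.const_mul A).integrableOn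
      · exact (hint.sub (hFint.const_mul A)).integrableOn
    have herr : ‖∫ t in Set.Ioi t₀, (G t - A * (F t * (Real.exp (-ε * t ^ 2) : ℂ)))‖ ≤ 4 * C := by
      have hi : MeasureTheory.IntegrableOn (fun t : ℝ => C * t ^ (-(5 / 4) : ℝ)) (Set.Ioi t₀) :=
        (integrableOn_Ioi_rpow_of_lt (by norm_num) (by linarith)).const_mul C
      refine (MeasureTheory.norm_integral_le_of_norm_le hi ?_).trans ?_
      · refine (MeasureTheory.ae_restrict_iff' measurableSet_Ioi).mpr (Eventually.of_forall ?_)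
        intro t ht
        have ht' : t₀ ≤ t := le_of_lt ht
        have heq : G t - A * (F t * (Real.exp (-ε * t ^ 2) : ℂ)) =
            (k t - A * (((t ^ (-(1 / 4) : ℝ) : ℝ) : ℂ) *
              Complex.exp (((-6 * (t * Real.log t - t) : ℝ) : ℂ) * Complex.I))) *
            Complex.exp (((6 * t * Real.log X : ℝ) : ℂ) * Complex.I) *
              (Real.exp (-ε * t ^ 2) : ℂ) := by
          have : Complex.exp (logPhase X t * Complex.I) =
              Complex.exp (((-6 * (t * Real.log t - t) : ℝ) : ℂ) * Complex.I) *
                Complex.exp (((6 * t * Real.log X : ℝ) : ℂ) * Complex.I) := by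
            rw [← Complex.exp_add, logPhase]
            congr 1
            push_cast
            ring
          simp only [hG, hg, hF, max_eq_left ht', this]
          ring
        rw [heq, norm_mul, norm_mul, Complex.norm_exp_ofReal_mul_I, mul_one]
        have h0 : 0 ≤ C * t ^ (-(5 / 4) : ℝ) :=
          mul_nonneg hC (Real.rpow_nonneg (by linarith) _)
        calc _ ≤ (C * t ^ (-(5 / 4) : ℝ)) * 1 := mul_le_mul (h t ht') (hw1 t) (norm_nonneg _) h0
          _ = _ := mul_one _
      · rw [MeasureTheory.integral_const_mul, integral_Ioi_rpow_of_lt (by norm_num) (by linarith)]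
        have h1 : t₀ ^ (-(5 / 4) + 1 : ℝ) ≤ 1 :=
          Real.rpow_le_one_of_one_le_of_nonpos ht₀ (by norm_num)
        have h2 : -t₀ ^ (-(5 / 4) + 1 : ℝ) / (-(5 / 4) + 1) ≤ 4 := by
          norm_num at h1 ⊢
          linarith
        nlinarith
    refine (norm_add_le _ _).trans ?_
    rw [hdecomp]
    have n1 := norm_add_le (A * (∫ t in Set.Ioi t₀, F t * (Real.exp (-ε * t ^ 2) : ℂ)))
      (∫ t in Set.Ioi t₀, (G t - A * (F t * (Real.exp (-ε * t ^ 2) : ℂ))))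
    rw [norm_mul] at n1
    have n2 := mul_le_mul_of_nonneg_left hmain (norm_nonneg A)
    have n3 : B * t₀ ≤ B * t₀ * X ^ (1 / 4 : ℝ) := le_mul_of_one_le_right (by positivity) hXr
    have n4 : 4 * C ≤ 4 * C * X ^ (1 / 4 : ℝ) := le_mul_of_one_le_right (by positivity) hXr
    linarith
  rw [hsplit]
  refine (norm_add_le _ _).trans ?_
  rw [Complex.norm_conj]
  linarith

/-- The main term of Stirling's formula for `log Γ`, without the constant. -/
noncomputable def stirlingMain (z : ℂ) : ℂ := (z - 1 / 2) * Complex.log z - z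

/-- The increment of `log Γ - stirlingMain` under `z ↦ z + 1`, up to sign. -/
noncomputable def stirlingStep (z : ℂ) : ℂ :=
  (z + 1 / 2) * (Complex.log (z + 1) - Complex.log z) - 1

theorem log_add_one_sub_log {z : ℂ} (hz : 0 < z.im) :
    Complex.log (z + 1) - Complex.log z = Complex.log (1 + z⁻¹) := by
  have hz0 : z ≠ 0 := fun h => by simp [h] at hz
  have him : (1 + z⁻¹).im < 0 := by
    rw [Complex.add_im, Complex.one_im, zero_add, Complex.inv_im]
    exact div_neg_of_neg_of_pos (by linarith) (Complex.normSq_pos.mpr hz0)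
  have h1 : (1 + z⁻¹) ≠ 0 := fun h => by simp [h] at him
  have e : z + 1 = z * (1 + z⁻¹) := by field_simp
  have a1 := Complex.arg_le_pi z
  have a2 := Complex.arg_nonneg_iff.mpr hz.le
  have a3 := Complex.arg_neg_iff.mpr him
  have a4 := Complex.neg_pi_lt_arg (1 + z⁻¹)
  rw [e, Complex.log_mul hz0 h1 ⟨by linarith, by linarith⟩]
  ring

theorem norm_stirlingStep_le {z : ℂ} (hz : 0 < z.im) (h2 : 2 ≤ ‖z‖) :
    ‖stirlingStep z‖ ≤ 2 * (‖z‖ ^ 2)⁻¹ := by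
  have hz0 : z ≠ 0 := fun h => by simp [h] at hz
  set u := z⁻¹ with hu
  have hun : ‖u‖ ≤ 1 / 2 := by
    rw [hu, norm_inv, inv_eq_one_div]
    exact one_div_le_one_div_of_le (by norm_num) h2
  have hT := Complex.norm_log_sub_logTaylor_le 2 (show ‖u‖ < 1 by linarith)
  have hTay : Complex.logTaylor (2 + 1) u = u - u ^ 2 / 2 := by
    simp [Complex.logTaylor, Finset.sum_range_succ]
    ring
  rw [hTay] at hT
  set r := Complex.log (1 + u) - (u - u ^ 2 / 2) with hr
  have hrn : ‖r‖ ≤ 2 / 3 * ‖u‖ ^ 3 := by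
    refine hT.trans ?_
    have h3 : (1 - ‖u‖)⁻¹ ≤ 2 := by
      rw [inv_le_comm₀ (by linarith) (by norm_num)]; linarith
    have h4 : 0 ≤ ‖u‖ ^ 3 := by positivity
    norm_num
    nlinarith
  have hu0 : u ≠ 0 := inv_ne_zero hz0
  have hzu : z = u⁻¹ := by rw [hu, inv_inv]
  have key : stirlingStep z = -u ^ 2 / 4 + r / u + r / 2 := by
    rw [stirlingStep, log_add_one_sub_log hz, ← hu, hr, hzu]
    field_simp
    ring
  have e1 : ‖-u ^ 2 / 4‖ = ‖u‖ ^ 2 / 4 := by simp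
  have e2 : ‖r / u‖ ≤ 2 / 3 * ‖u‖ ^ 2 := by
    rw [norm_div, div_le_iff₀ (norm_pos_iff.mpr hu0)]
    calc _ ≤ _ := hrn
      _ = _ := by ring
  have e3 : ‖r / 2‖ ≤ 1 / 6 * ‖u‖ ^ 2 := by
    rw [norm_div, Complex.norm_ofNat, div_le_iff₀ (by norm_num)]
    have : ‖u‖ ^ 3 = ‖u‖ ^ 2 * ‖u‖ := by ring
    nlinarith [sq_nonneg ‖u‖]
  have e4 : (‖z‖ ^ 2)⁻¹ = ‖u‖ ^ 2 := by rw [hu, norm_inv, inv_pow]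
  rw [key, e4]
  have n1 := norm_add_le (-u ^ 2 / 4 + r / u) (r / 2)
  have n2 := norm_add_le (-u ^ 2 / 4) (r / u)
  nlinarith [sq_nonneg ‖u‖]

theorem Gamma_eq_mul_exp_sum_stirlingStep {z : ℂ} (hz : 0 < z.im) (n : ℕ) :
    Complex.Gamma z * Complex.exp (-stirlingMain z) =
      Complex.Gamma (z + n) * Complex.exp (-stirlingMain (z + n)) *
        Complex.exp (∑ k ∈ Finset.range n, stirlingStep (z + k)) := by
  induction n with
  | zero => simp
  | succ n ih =>
    have him : 0 < (z + n).im := by simpa using hz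
    have h0 : z + n ≠ 0 := fun h => by simp [h] at him
    rw [ih, Finset.sum_range_succ, Complex.exp_add]
    have e : z + ((n + 1 : ℕ) : ℂ) = (z + n) + 1 := by push_cast; ring
    rw [e, Complex.Gamma_add_one _ h0]
    have hs : -stirlingMain (z + n) =
        Complex.log (z + n) + (-stirlingMain (z + n + 1) + stirlingStep (z + n)) := by
      simp only [stirlingMain, stirlingStep]
      ring
    rw [hs, Complex.exp_add, Complex.exp_log h0, Complex.exp_add]
    ring

theorem tendsto_Gamma_add_nat_mul_exp (z : ℂ) (hz : 0 < z.im) :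
    Tendsto (fun n : ℕ => Complex.Gamma (z + n) * Complex.exp (-stirlingMain (z + n)))
      atTop (nhds (Real.sqrt (2 * π) : ℂ)) := by
  rw [← tendsto_add_atTop_iff_nat 1]
  have hzne : ∀ m : ℕ, z ≠ -m := fun m h => by simp [h] at hz
  have hG0 := Complex.Gamma_ne_zero hzne
  have t1 : Tendsto (fun n : ℕ => Complex.Gamma z / Complex.GammaSeq z n) atTop (nhds 1) := by
    have := (tendsto_const_nhds (x := Complex.Gamma z)).div (Complex.GammaSeq_tendsto_Gamma z) hG0
    rwa [div_self hG0] at this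
  have t2 : Tendsto (fun n : ℕ => (Stirling.stirlingSeq n : ℂ)) atTop (nhds (Real.sqrt π : ℂ)) :=
    (Complex.continuous_ofReal.tendsto _).comp Stirling.tendsto_stirlingSeq_sqrt_pi
  have t0 : Tendsto (fun n : ℕ => (n : ℂ) * ((z + 1) / n)) atTop (nhds (z + 1)) := by
    refine tendsto_const_nhds.congr' ?_
    filter_upwards [eventually_gt_atTop 0] with n hn
    have : (n : ℂ) ≠ 0 := by exact_mod_cast hn.ne'
    field_simp
  have t3 := Complex.tendsto_nat_mul_log_one_add_of_tendsto t0
  have t4 : Tendsto (fun n : ℕ => Complex.log (1 + (z + 1) / n)) atTop (nhds 0) := by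
    have h := t3.mul (tendsto_inv_atTop_nhds_zero_nat (𝕜 := ℂ))
    rw [mul_zero] at h
    refine h.congr' ?_
    filter_upwards [eventually_gt_atTop 0] with n hn
    have : (n : ℂ) ≠ 0 := by exact_mod_cast hn.ne'
    field_simp
  have t5 : Tendsto (fun n : ℕ => Complex.exp (-((n : ℂ) * Complex.log (1 + (z + 1) / n)
      + (z + 1 / 2) * Complex.log (1 + (z + 1) / n)) + (z + 1))) atTop (nhds 1) := by
    have h := (((t3.add (t4.const_mul (z + 1 / 2))).neg.add_const (z + 1))).cexp
    simpa using h
  have t6 := ((t1.mul t2).mul t5).mul_const (Real.sqrt 2 : ℂ)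
  have hlim : (1 * (Real.sqrt π : ℂ) * 1 * (Real.sqrt 2 : ℂ)) = (Real.sqrt (2 * π) : ℂ) := by
    rw [Real.sqrt_mul (by norm_num)]
    push_cast
    ring
  rw [hlim] at t6
  refine t6.congr' ?_
  filter_upwards [eventually_gt_atTop 0] with n hn
  have hnR : (0 : ℝ) < n := by exact_mod_cast hn
  have hnC : (n : ℂ) ≠ 0 := by exact_mod_cast hn.ne'
  have hne1 : (1 + (z + 1) / n : ℂ) ≠ 0 := by
    intro h
    have h2 : (n : ℂ) + (z + 1) = 0 := by
      field_simp at h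
      linear_combination h
    have := congrArg Complex.im h2
    simp at this
    linarith
  have hlog : Complex.log (z + ((n + 1 : ℕ) : ℂ)) =
      Real.log n + Complex.log (1 + (z + 1) / n) := by
    rw [← Complex.log_ofReal_mul hnR hne1]
    congr 1
    push_cast
    field_simp
    ring
  have hprod : ∏ j ∈ Finset.range (n + 1), (z + j) =
      Complex.Gamma (z + ((n + 1 : ℕ) : ℂ)) / Complex.Gamma z := by
    rw [Complex.Gamma_add_nat_div_Gamma_eq z hzne]
    generalize n + 1 = m
    induction m with
    | zero => simp
    | succ m ih => rw [Finset.prod_range_succ, ih, ascPochhammer_succ_eval]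
  have hf0 : (n.factorial : ℂ) ≠ 0 := by exact_mod_cast n.factorial_ne_zero
  set lg : ℂ := Complex.log (1 + (z + 1) / n) with hlg
  set ln : ℂ := (Real.log n : ℂ) with hln
  have hexpn : Complex.exp ln = n := by
    rw [hln, ← Complex.ofReal_exp, Real.exp_log hnR]; simp
  have hnz : (n : ℂ) ^ z = Complex.exp (ln * z) := by
    rw [Complex.cpow_def_of_ne_zero hnC, hln, Complex.ofReal_log hnR.le]; simp
  have hst : ((Stirling.stirlingSeq n : ℝ) : ℂ) * (Real.sqrt 2 : ℂ) =
      n.factorial * Complex.exp (-(ln / 2 + n * ln - n)) := by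
    rw [Stirling.stirlingSeq]
    have hsq : ((Real.sqrt n : ℝ) : ℂ) = Complex.exp (ln / 2) := by
      rw [Real.sqrt_eq_rpow, Real.rpow_def_of_pos hnR, hln]
      push_cast
      congr 1
      ring
    have hp : (((n : ℝ) / Real.exp 1 : ℝ) : ℂ) ^ n = Complex.exp (n * ln - n) := by
      rw [show (n : ℂ) * ln - n = n * (ln - 1) by ring, Complex.exp_nat_mul, Complex.exp_sub, hexpn]
      push_cast
      rfl
    rw [Real.sqrt_mul (by norm_num), Complex.ofReal_div, Complex.ofReal_mul, Complex.ofReal_mul,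
      Complex.ofReal_pow, hp, hsq, Complex.ofReal_natCast, Complex.exp_neg,
      show ln / 2 + n * ln - n = ln / 2 + (n * ln - n) by ring, Complex.exp_add]
    have s2 : ((Real.sqrt 2 : ℝ) : ℂ) ≠ 0 := by
      exact_mod_cast (Real.sqrt_pos.mpr (by norm_num : (0 : ℝ) < 2)).ne'
    have x1 := Complex.exp_ne_zero (ln / 2)
    have x2 := Complex.exp_ne_zero (n * ln - n)
    field_simp
  rw [Complex.GammaSeq, hprod, hnz, stirlingMain, hlog]
  rw [show ∀ a b c d : ℂ, a * b * c * d = a * (b * d) * c by intros; ring, hst]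
  have hGn : Complex.Gamma (z + ((n + 1 : ℕ) : ℂ)) ≠ 0 := by
    apply Complex.Gamma_ne_zero
    intro m h
    have := congrArg Complex.im h
    simp at this
    linarith
  have hexp : Complex.exp (-((z + ((n + 1 : ℕ) : ℂ) - 1 / 2) * (ln + lg) - (z + ((n + 1 : ℕ) : ℂ))))
      = Complex.exp (-(ln / 2 + n * ln - n)) * (Complex.exp (ln * z))⁻¹ *
        Complex.exp (-(n * lg + (z + 1 / 2) * lg) + (z + 1)) := by
    rw [← Complex.exp_neg, ← Complex.exp_add, ← Complex.exp_add]
    congr 1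
    push_cast
    ring
  rw [hexp]
  have x1 := Complex.exp_ne_zero (ln * z)
  field_simp

theorem exists_Gamma_eq_stirlingMain (α : ℝ) : ∃ R : ℝ → ℂ, (R =O[atTop] fun τ => τ⁻¹) ∧
    ∀ᶠ τ : ℝ in atTop, Complex.Gamma (α + τ * Complex.I) =
      Real.sqrt (2 * π) * Complex.exp (stirlingMain (α + τ * Complex.I)) * Complex.exp (R τ) := by
  refine ⟨fun τ => ∑' k : ℕ, stirlingStep (α + τ * Complex.I + k), ?_⟩
  have key : ∀ τ : ℝ, 2 * (|α| + 1) ≤ τ →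
      Summable (fun k : ℕ => stirlingStep (α + τ * Complex.I + k)) ∧
      ‖∑' k : ℕ, stirlingStep (α + τ * Complex.I + k)‖ ≤ 16 * τ⁻¹ := by
    intro τ hτ
    have hα0 := abs_nonneg α
    have hτ2 : 2 ≤ τ := by linarith
    have hterm : ∀ k : ℕ, ‖stirlingStep (α + τ * Complex.I + k)‖ ≤
        8 * ((τ - 1 + k)⁻¹ - (τ - 1 + ((k + 1 : ℕ) : ℝ))⁻¹) := by
      intro k
      have hk : (0 : ℝ) ≤ k := Nat.cast_nonneg k
      have him : (α + τ * Complex.I + k : ℂ).im = τ := by simp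
      have hre : (α + τ * Complex.I + k : ℂ).re = α + k := by simp
      have hsq : ‖(α + τ * Complex.I + k : ℂ)‖ ^ 2 = (α + k) ^ 2 + τ ^ 2 := by
        rw [Complex.sq_norm, Complex.normSq_apply, him, hre]; ring
      have hge : (k + τ) ^ 2 / 4 ≤ ‖(α + τ * Complex.I + k : ℂ)‖ ^ 2 := by
        rw [hsq]
        have h1 : 4 * α ^ 2 ≤ τ ^ 2 := by
          rw [← sq_abs α]; nlinarith
        nlinarith [sq_nonneg (k + 2 * α), sq_nonneg (k - τ)]
      have h2 : 2 ≤ ‖(α + τ * Complex.I + k : ℂ)‖ := by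
        have := Complex.abs_im_le_norm (α + τ * Complex.I + k : ℂ)
        rw [him, abs_of_nonneg (by linarith)] at this
        linarith
      refine (norm_stirlingStep_le (by rw [him]; linarith) h2).trans ?_
      have h3 : (‖(α + τ * Complex.I + k : ℂ)‖ ^ 2)⁻¹ ≤ ((k + τ) ^ 2 / 4)⁻¹ :=
        inv_anti₀ (by positivity) hge
      have h4 : ((k + τ) ^ 2)⁻¹ ≤ (τ - 1 + k)⁻¹ - (τ - 1 + ((k + 1 : ℕ) : ℝ))⁻¹ := by
        push_cast
        rw [inv_sub_inv (by linarith) (by linarith), inv_eq_one_div,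
          div_le_div_iff₀ (by positivity) (mul_pos (by linarith) (by linarith))]
        nlinarith
      rw [inv_div] at h3
      have h5 : (4 : ℝ) / (k + τ) ^ 2 = 4 * ((k + τ) ^ 2)⁻¹ := by rw [div_eq_mul_inv]
      linarith
    have hsumle : ∀ n : ℕ, ∑ k ∈ Finset.range n, ‖stirlingStep (α + τ * Complex.I + k)‖ ≤
        16 * τ⁻¹ := by
      intro n
      refine (Finset.sum_le_sum fun k _ => hterm k).trans ?_
      rw [← Finset.mul_sum, Finset.sum_range_sub' (fun k : ℕ => (τ - 1 + (k : ℝ))⁻¹)]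
      have h1 : 0 ≤ (τ - 1 + (n : ℝ))⁻¹ := inv_nonneg.mpr (by
        have : (0 : ℝ) ≤ n := Nat.cast_nonneg n
        linarith)
      have h2 : (τ - 1 + ((0 : ℕ) : ℝ))⁻¹ ≤ 2 * τ⁻¹ := by
        rw [Nat.cast_zero, add_zero, ← div_eq_mul_inv, inv_eq_one_div,
          div_le_div_iff₀ (by linarith) (by linarith)]
        linarith
      linarith
    have hs := summable_of_sum_range_le (fun _ => norm_nonneg _) hsumle
    exact ⟨hs.of_norm, (norm_tsum_le_tsum_norm hs).trans
      (Real.tsum_le_of_sum_range_le (fun _ => norm_nonneg _) hsumle)⟩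
  constructor
  · apply IsBigO.of_bound 16
    filter_upwards [eventually_ge_atTop (2 * (|α| + 1))] with τ hτ
    have : 0 < τ := by linarith [abs_nonneg α]
    rw [Real.norm_of_nonneg (inv_pos.mpr this).le]
    exact (key τ hτ).2
  · filter_upwards [eventually_ge_atTop (2 * (|α| + 1))] with τ hτ
    have him : 0 < (α + τ * Complex.I : ℂ).im := by
      simp
      linarith [abs_nonneg α]
    have h1 := (tendsto_Gamma_add_nat_mul_exp _ him).mul ((key τ hτ).1.hasSum.tendsto_sum_nat.cexp)
    have h2 := tendsto_nhds_unique (tendsto_const_nhds.congr fun n =>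
      Gamma_eq_mul_exp_sum_stirlingStep him n) h1
    rw [mul_right_comm, ← h2, mul_assoc, ← Complex.exp_add]
    simp

/-- Stirling's formula for `Γ` on a vertical line. -/
theorem exists_Gamma_vertical_eq (α : ℝ) : ∃ R : ℝ → ℂ, (R =O[atTop] fun τ => τ⁻¹) ∧
    ∀ᶠ τ : ℝ in atTop, Complex.Gamma (α + τ * Complex.I) =
      Complex.exp ((Real.log (Real.sqrt (2 * π)) : ℂ) +
        (α - 1 / 2 + τ * Complex.I) * (Real.log τ + π / 2 * Complex.I) - τ * Complex.I + R τ) := by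
  obtain ⟨R, hR, hG⟩ := exists_Gamma_eq_stirlingMain α
  set u : ℝ → ℂ := fun τ => -(α * Complex.I) / τ with hu
  refine ⟨fun τ => ((α - 1 / 2 + τ * Complex.I) * Complex.log (1 + u τ) - α) + R τ, ?_, ?_⟩
  · refine IsBigO.add ?_ hR
    apply IsBigO.of_bound (α ^ 2 + |α| * (|α| + 1 / 2) * 2 + α ^ 2 * (|α| + 1 / 2))
    filter_upwards [eventually_ge_atTop (2 * (|α| + 1))] with τ hτ
    have ha := abs_nonneg α
    have hτ0 : 0 < τ := by linarith
    have hun : ‖u τ‖ = |α| * τ⁻¹ := by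
      simp only [hu]
      rw [norm_div, norm_neg, norm_mul, Complex.norm_I, Complex.norm_real, Complex.norm_real,
        Real.norm_eq_abs, Real.norm_of_nonneg hτ0.le]
      ring
    have hτi : τ⁻¹ ≤ 1 := inv_le_one_of_one_le₀ (by linarith)
    have hτi0 : 0 < τ⁻¹ := inv_pos.mpr hτ0
    have hτi1 : τ * τ⁻¹ = 1 := mul_inv_cancel₀ hτ0.ne'
    have hu2 : ‖u τ‖ ≤ 1 / 2 := by
      rw [hun]
      have : |α| * τ⁻¹ ≤ (τ / 2) * τ⁻¹ := by gcongr; linarith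
      linarith
    have hl := Complex.norm_log_one_add_sub_self_le (show ‖u τ‖ < 1 by linarith)
    have hl2 : ‖Complex.log (1 + u τ) - u τ‖ ≤ ‖u τ‖ ^ 2 := by
      refine hl.trans ?_
      have h3 : (1 - ‖u τ‖)⁻¹ ≤ 2 := by
        rw [inv_le_comm₀ (by linarith) (by norm_num)]; linarith
      nlinarith [sq_nonneg ‖u τ‖]
    have hτC : (τ : ℂ) ≠ 0 := by exact_mod_cast hτ0.ne'
    have heq : (α - 1 / 2 + τ * Complex.I) * Complex.log (1 + u τ) - α =
        τ * Complex.I * (Complex.log (1 + u τ) - u τ) + (α - 1 / 2) * u τ +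
          (α - 1 / 2) * (Complex.log (1 + u τ) - u τ) := by
      have : τ * Complex.I * u τ = α := by
        simp only [hu]
        field_simp
        linear_combination (-(α : ℂ)) * Complex.I_sq
      linear_combination this
    have hα2 : ‖(α - 1 / 2 : ℂ)‖ ≤ |α| + 1 / 2 := by
      have := norm_sub_le (α : ℂ) (1 / 2)
      rw [Complex.norm_real, Real.norm_eq_abs] at this
      norm_num at this ⊢
      exact this
    rw [heq, Real.norm_of_nonneg hτi0.le]
    have n1 := norm_add_le (τ * Complex.I * (Complex.log (1 + u τ) - u τ) + (α - 1 / 2) * u τ)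
      ((α - 1 / 2) * (Complex.log (1 + u τ) - u τ))
    have n2 := norm_add_le (τ * Complex.I * (Complex.log (1 + u τ) - u τ)) ((α - 1 / 2) * u τ)
    have m1 : ‖τ * Complex.I * (Complex.log (1 + u τ) - u τ)‖ ≤ α ^ 2 * τ⁻¹ := by
      rw [norm_mul, norm_mul, Complex.norm_I, Complex.norm_real, Real.norm_of_nonneg hτ0.le, mul_one]
      calc τ * _ ≤ τ * ‖u τ‖ ^ 2 := by gcongr
        _ = α ^ 2 * τ⁻¹ := by
          rw [hun, mul_pow, sq_abs]
          field_simp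
    have m2 : ‖(α - 1 / 2) * u τ‖ ≤ (|α| + 1 / 2) * (|α| * τ⁻¹) := by
      rw [norm_mul, ← hun]
      gcongr
    have m3 : ‖(α - 1 / 2) * (Complex.log (1 + u τ) - u τ)‖ ≤ (|α| + 1 / 2) * (α ^ 2 * τ⁻¹) := by
      rw [norm_mul]
      have : ‖u τ‖ ^ 2 ≤ α ^ 2 * τ⁻¹ := by
        rw [hun, mul_pow, sq_abs]
        have : τ⁻¹ ^ 2 ≤ τ⁻¹ := by nlinarith
        nlinarith [sq_nonneg α]
      exact mul_le_mul hα2 (hl2.trans this) (norm_nonneg _) (by linarith)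
    have m4 : 0 ≤ |α| * (|α| + 1 / 2) * τ⁻¹ := by positivity
    nlinarith
  · filter_upwards [hG, eventually_gt_atTop 0] with τ hτ hτ0
    have hτC : (τ : ℂ) ≠ 0 := by exact_mod_cast hτ0.ne'
    have hfac : (α + τ * Complex.I : ℂ) = τ * (Complex.I * (1 + u τ)) := by
      simp only [hu]
      field_simp
      linear_combination (α : ℂ) * Complex.I_sq
    have hure : (1 + u τ).re = 1 := by
      simp [hu, Complex.div_re]
    have hne : 1 + u τ ≠ 0 := fun h => by simp [h] at hure
    have hlog : Complex.log (α + τ * Complex.I) =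
        Real.log τ + π / 2 * Complex.I + Complex.log (1 + u τ) := by
      rw [hfac, Complex.log_ofReal_mul hτ0 (mul_ne_zero Complex.I_ne_zero hne),
        Complex.log_mul Complex.I_ne_zero hne, Complex.log_I]
      · ring
      · rw [Complex.arg_I]
        have := Complex.abs_arg_lt_pi_div_two_iff.mpr (Or.inl (show 0 < (1 + u τ).re by
          rw [hure]; norm_num))
        rw [abs_lt] at this
        exact ⟨by linarith, by linarith⟩
    rw [hτ, stirlingMain, hlog]
    have hs : 0 < Real.sqrt (2 * π) := Real.sqrt_pos.mpr (by positivity)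
    nth_rewrite 1 [← Real.exp_log hs]
    rw [Complex.ofReal_exp, ← Complex.exp_add, ← Complex.exp_add]
    congr 1
    ring

lemma norm_Gamma_le_Gamma_re {z : ℂ} (hz : 0 < z.re) : ‖Complex.Gamma z‖ ≤ Real.Gamma z.re := by
  rw [Complex.Gamma_eq_integral hz, Real.Gamma_eq_integral hz, Complex.GammaIntegral]
  refine MeasureTheory.norm_integral_le_of_norm_le (Real.GammaIntegral_convergent hz) ?_
  refine (MeasureTheory.ae_restrict_iff' measurableSet_Ioi).mpr (.of_forall fun t ht => ?_)
  have ht : 0 < t := ht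
  rw [norm_mul, Complex.norm_cpow_eq_rpow_re_of_pos ht, Complex.norm_real,
    Real.norm_of_nonneg (Real.exp_pos _).le, Complex.sub_re, Complex.one_re]

/-- At most exponential growth in the imaginary direction, in every vertical strip. -/
def ExpBoundedOnStrips (f : ℂ → ℂ) : Prop :=
  ∀ a b : ℝ, ∃ C c : ℝ, 0 ≤ C ∧ 0 ≤ c ∧ ∀ w : ℂ, a ≤ w.re → w.re ≤ b → 1 ≤ |w.im| →
    ‖f w‖ ≤ C * Real.exp (c * |w.im|)

namespace ExpBoundedOnStrips

variable {f g : ℂ → ℂ}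

lemma mul (hf : ExpBoundedOnStrips f) (hg : ExpBoundedOnStrips g) :
    ExpBoundedOnStrips (fun w => f w * g w) := by
  intro a b
  obtain ⟨C, c, hC, hc, h⟩ := hf a b
  obtain ⟨C', c', hC', hc', h'⟩ := hg a b
  refine ⟨C * C', c + c', by positivity, by positivity, fun w h1 h2 h3 => ?_⟩
  rw [norm_mul, add_mul, Real.exp_add]
  calc _ ≤ (C * Real.exp (c * |w.im|)) * (C' * Real.exp (c' * |w.im|)) := by
        gcongr
        · exact h w h1 h2 h3
        · exact h' w h1 h2 h3
    _ = _ := by ring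

lemma pow (hf : ExpBoundedOnStrips f) (n : ℕ) : ExpBoundedOnStrips (fun w => f w ^ n) := by
  induction n with
  | zero => exact fun a b => ⟨1, 0, by norm_num, le_rfl, fun w _ _ _ => by simp⟩
  | succ n ih => simpa only [pow_succ] using ih.mul hf

lemma add (hf : ExpBoundedOnStrips f) (hg : ExpBoundedOnStrips g) :
    ExpBoundedOnStrips (fun w => f w + g w) := by
  intro a b
  obtain ⟨C, c, hC, hc, h⟩ := hf a b
  obtain ⟨C', c', hC', hc', h'⟩ := hg a b
  refine ⟨C + C', c + c', by positivity, by positivity, fun w h1 h2 h3 => ?_⟩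
  have e1 : Real.exp (c * |w.im|) ≤ Real.exp ((c + c') * |w.im|) := by gcongr; linarith
  have e2 : Real.exp (c' * |w.im|) ≤ Real.exp ((c + c') * |w.im|) := by gcongr; linarith
  calc _ ≤ ‖f w‖ + ‖g w‖ := norm_add_le _ _
    _ ≤ C * Real.exp (c * |w.im|) + C' * Real.exp (c' * |w.im|) :=
        add_le_add (h w h1 h2 h3) (h' w h1 h2 h3)
    _ ≤ C * Real.exp ((c + c') * |w.im|) + C' * Real.exp ((c + c') * |w.im|) := by gcongr
    _ = _ := by ring

lemma comp_mul_add (hf : ExpBoundedOnStrips f) {r : ℝ} (hr : 1 ≤ r) (d : ℝ) :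
    ExpBoundedOnStrips (fun w => f (r * w + d)) := by
  intro a b
  obtain ⟨C, c, hC, hc, h⟩ := hf (r * a + d) (r * b + d)
  refine ⟨C, c * r, hC, by positivity, fun w h1 h2 h3 => ?_⟩
  have hr0 : 0 < r := by linarith
  have him : |(r * w + d : ℂ).im| = r * |w.im| := by simp [abs_mul, abs_of_pos hr0]
  have := h (r * w + d) (by simp; gcongr) (by simp; gcongr) (by rw [him]; nlinarith)
  rwa [him, ← mul_assoc] at this

lemma of_bounded (h : ∀ a b : ℝ, ∃ C, ∀ w : ℂ, a ≤ w.re → w.re ≤ b → ‖f w‖ ≤ C) :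
    ExpBoundedOnStrips f := by
  intro a b
  obtain ⟨C, h⟩ := h a b
  refine ⟨|C|, 0, abs_nonneg _, le_rfl, fun w h1 h2 _ => ?_⟩
  simpa using (h w h1 h2).trans (le_abs_self C)

lemma const (z : ℂ) : ExpBoundedOnStrips (fun _ => z) :=
  of_bounded fun _ _ => ⟨‖z‖, fun _ _ _ => le_rfl⟩

lemma id : ExpBoundedOnStrips (fun w => w) := by
  intro a b
  refine ⟨|a| + |b| + 1, 1, by positivity, by norm_num, fun w h1 h2 h3 => ?_⟩
  have h4 : |w.re| ≤ |a| + |b| := by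
    rw [abs_le]
    exact ⟨by linarith [neg_abs_le a, abs_nonneg b], by linarith [le_abs_self b, abs_nonneg a]⟩
  have h5 := Complex.norm_le_abs_re_add_abs_im w
  have h6 := Real.add_one_le_exp |w.im|
  rw [one_mul]
  nlinarith [abs_nonneg a, abs_nonneg b]

lemma cpow_const {x : ℝ} (hx : 0 < x) (c : ℝ) :
    ExpBoundedOnStrips (fun w => (x : ℂ) ^ ((c : ℂ) * w)) := by
  apply of_bounded
  intro a b
  refine ⟨(x ^ c) ^ a + (x ^ c) ^ b, fun w h1 h2 => ?_⟩
  have hy : 0 < x ^ c := by positivity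
  rw [Complex.norm_cpow_eq_rpow_re_of_pos hx]
  simp only [Complex.mul_re, Complex.ofReal_re, Complex.ofReal_im, zero_mul, sub_zero]
  rw [Real.rpow_mul hx.le]
  have p1 : 0 < (x ^ c) ^ a := by positivity
  have p2 : 0 < (x ^ c) ^ b := by positivity
  rcases le_total 1 (x ^ c) with h | h
  · have := Real.rpow_le_rpow_of_exponent_le h h2
    linarith
  · have := Real.rpow_le_rpow_of_exponent_ge hy h h1
    linarith

lemma inv_Gamma : ExpBoundedOnStrips (fun w => (Complex.Gamma w)⁻¹) := by
  have key : ∀ m : ℕ, ∀ a b : ℝ, b ≤ 1 / 2 + m → ∃ C c : ℝ, 0 ≤ C ∧ 0 ≤ c ∧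
      ∀ w : ℂ, a ≤ w.re → w.re ≤ b → 1 ≤ |w.im| →
        ‖(Complex.Gamma w)⁻¹‖ ≤ C * Real.exp (c * |w.im|) := by
    intro m
    induction m with
    | zero =>
      intro a b hb
      simp only [Nat.cast_zero, add_zero] at hb
      obtain ⟨B, hB⟩ := (isCompact_Icc (a := a) (b := b)).exists_bound_of_continuousOn
        (f := fun σ : ℝ => Real.Gamma (1 - σ)) (by
          intro σ hσ
          refine ContinuousAt.continuousWithinAt ?_
          refine ContinuousAt.comp (g := Real.Gamma) ?_ (by fun_prop)
          refine (Real.differentiableAt_Gamma fun k => ?_).continuousAt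
          have := hσ.2
          have : (0 : ℝ) ≤ k := k.cast_nonneg
          intro h
          linarith)
      refine ⟨|B|, π, abs_nonneg _, Real.pi_pos.le, fun w h1 h2 h3 => ?_⟩
      have hsin : Complex.sin (π * w) ≠ 0 := by
        rw [Complex.sin_ne_zero_iff]
        intro k hk
        have := congrArg Complex.im hk
        simp at this
        rw [this] at h3
        norm_num at h3
      have hπ : (π : ℂ) ≠ 0 := by exact_mod_cast Real.pi_ne_zero
      have hrefl := Complex.Gamma_mul_Gamma_one_sub w
      have hG0 : Complex.Gamma w ≠ 0 := by
        intro h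
        rw [h, zero_mul, eq_comm, div_eq_zero_iff] at hrefl
        tauto
      have e : (Complex.Gamma w)⁻¹ = Complex.Gamma (1 - w) * Complex.sin (π * w) / π := by
        rw [eq_div_iff hπ, ← mul_right_inj' hG0, ← mul_assoc, ← mul_assoc, hrefl]
        field_simp
      have g1 : ‖Complex.Gamma (1 - w)‖ ≤ |B| := by
        have h4 : 0 < (1 - w).re := by simp; linarith
        have h5 : ‖Complex.Gamma (1 - w)‖ ≤ Real.Gamma (1 - w).re := norm_Gamma_le_Gamma_re h4
        have := hB w.re ⟨h1, h2⟩
        rw [Real.norm_eq_abs] at this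
        have h6 : (1 - w).re = 1 - w.re := by simp
        rw [h6] at h5
        linarith [le_abs_self (Real.Gamma (1 - w.re)), le_abs_self B]
      have g2 : ‖Complex.sin (π * w)‖ ≤ Real.exp (π * |w.im|) := by
        rw [Complex.sin, norm_div, norm_mul, Complex.norm_I, mul_one, Complex.norm_ofNat,
          div_le_iff₀ (by norm_num)]
        refine (norm_sub_le _ _).trans ?_
        rw [Complex.norm_exp, Complex.norm_exp]
        have r1 : (-(π * w) * Complex.I).re = π * w.im := by simp
        have r2 : (π * w * Complex.I).re = -(π * w.im) := by simp
        rw [r1, r2]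
        have : Real.exp (π * w.im) ≤ Real.exp (π * |w.im|) := by
          gcongr; exact le_abs_self _
        have : Real.exp (-(π * w.im)) ≤ Real.exp (π * |w.im|) := by
          rw [← mul_neg]
          gcongr; exact neg_le_abs _
        linarith
      rw [e, norm_div, norm_mul, Complex.norm_real, Real.norm_of_nonneg Real.pi_pos.le]
      calc _ ≤ ‖Complex.Gamma (1 - w)‖ * ‖Complex.sin (π * w)‖ :=
            div_le_self (by positivity) (by linarith [Real.pi_gt_three])
        _ ≤ _ := by gcongr
    | succ m ih =>
      intro a b hb
      obtain ⟨C, c, hC, hc, h⟩ := ih (a - 1) (b - 1) (by push_cast at hb; linarith)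
      refine ⟨C, c, hC, hc, fun w h1 h2 h3 => ?_⟩
      have h4 := h (w - 1) (by simpa using h1) (by simpa using h2) (by simpa using h3)
      have him : 1 ≤ ‖w - 1‖ := h3.trans (by simpa using Complex.abs_im_le_norm (w - 1))
      have hne : w - 1 ≠ 0 := norm_pos_iff.mp (by linarith)
      have e : Complex.Gamma w = (w - 1) * Complex.Gamma (w - 1) := by
        simpa using Complex.Gamma_add_one (w - 1) hne
      have h5 : (w - 1).im = w.im := by simp
      rw [h5] at h4
      rw [e, mul_inv, norm_mul, norm_inv (w - 1)]
      calc _ ≤ 1 * ‖(Complex.Gamma (w - 1))⁻¹‖ := by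
            gcongr; exact inv_le_one_of_one_le₀ him
        _ ≤ _ := by rwa [one_mul]
  intro a b
  obtain ⟨m, hm⟩ := exists_nat_ge b
  exact key m a b (by linarith)

end ExpBoundedOnStrips

lemma WeakFEPair.norm_Λ₀_le (P : WeakFEPair ℂ) (a b : ℝ) :
    ∃ C, ∀ w : ℂ, a ≤ w.re → w.re ≤ b → ‖P.Λ₀ w‖ ≤ C := by
  have hs := P.isStrongFEPair_toStrongFEPair
  have conv : ∀ s : ℂ, MeasureTheory.IntegrableOn
      (fun t : ℝ => (t : ℂ) ^ (s - 1) • P.f_modif t) (Set.Ioi 0) := fun s => (hs.hasMellin s).1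
  refine ⟨∫ t in Set.Ioi (0 : ℝ), (‖(t : ℂ) ^ ((a : ℂ) - 1) • P.f_modif t‖ +
    ‖(t : ℂ) ^ ((b : ℂ) - 1) • P.f_modif t‖), fun w h1 h2 => ?_⟩
  have e : P.Λ₀ w = ∫ t in Set.Ioi (0 : ℝ), (t : ℂ) ^ (w - 1) • P.f_modif t := rfl
  rw [e]
  refine MeasureTheory.norm_integral_le_of_norm_le ((conv a).norm.add (conv b).norm) ?_
  refine (MeasureTheory.ae_restrict_iff' measurableSet_Ioi).mpr (.of_forall fun t ht => ?_)
  have ht : 0 < t := ht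
  rw [norm_smul, norm_smul, norm_smul, ← add_mul]
  gcongr
  simp only [Complex.norm_cpow_eq_rpow_re_of_pos ht, Complex.sub_re, Complex.ofReal_re,
    Complex.one_re]
  have p1 : 0 < t ^ (a - 1) := by positivity
  have p2 : 0 < t ^ (b - 1) := by positivity
  rcases le_total 1 t with h | h
  · have := Real.rpow_le_rpow_of_exponent_le h (show w.re - 1 ≤ b - 1 by linarith)
    linarith
  · have := Real.rpow_le_rpow_of_exponent_ge ht h (show a - 1 ≤ w.re - 1 by linarith)
    linarith

lemma norm_completedHurwitzZetaEven₀_le (x : UnitAddCircle) (a b : ℝ) :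
    ∃ C, ∀ w : ℂ, a ≤ w.re → w.re ≤ b → ‖HurwitzZeta.completedHurwitzZetaEven₀ x w‖ ≤ C := by
  obtain ⟨C, hC⟩ := (HurwitzZeta.hurwitzEvenFEPair x).norm_Λ₀_le (a / 2) (b / 2)
  refine ⟨C / 2, fun w h1 h2 => ?_⟩
  have := hC (w / 2) (by simp; linarith) (by simp; linarith)
  rw [HurwitzZeta.completedHurwitzZetaEven₀, norm_div, Complex.norm_ofNat]
  linarith

lemma expBoundedOnStrips_completedRiemannZeta₀ : ExpBoundedOnStrips completedRiemannZeta₀ :=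
  .of_bounded fun a b => norm_completedHurwitzZetaEven₀_le 0 a b

lemma expBoundedOnStrips_completedLFunction {N : ℕ} [NeZero N] {χ : DirichletCharacter ℂ N}
    (heven : χ.Even) (hχ : χ ≠ 1) (hN : N ≠ 1) : ExpBoundedOnStrips χ.completedLFunction := by
  have hN0 : (0 : ℝ) < N := by exact_mod_cast Nat.pos_of_ne_zero (NeZero.ne N)
  have e : χ.completedLFunction = fun s => ((N : ℝ) : ℂ) ^ (((-1 : ℝ) : ℂ) * s) *
      ∑ j, χ j * HurwitzZeta.completedHurwitzZetaEven₀ (ZMod.toAddCircle j) s := by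
    funext s
    have h1 := ZMod.completedLFunction_eq (χ ·) s
    have h2 : ∑ j, χ j * HurwitzZeta.completedHurwitzZetaOdd (ZMod.toAddCircle j) s = 0 := by
      have hz : (fun j => χ j).Even := heven.to_fun
      refine (hz.mul_odd fun j => ?_).sum_eq_zero
      rw [map_neg, HurwitzZeta.completedHurwitzZetaOdd_neg]
    have h3 : ∑ j, χ j = 0 := MulChar.sum_eq_zero_of_ne_one hχ
    have h4 : χ 0 = 0 := DirichletCharacter.map_zero' χ hN
    rw [DirichletCharacter.completedLFunction]
    rw [h1, ZMod.completedLFunction₀, h2, h3, h4]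
    simp
  rw [e]
  refine (ExpBoundedOnStrips.cpow_const hN0 (-1)).mul (.of_bounded fun a b => ?_)
  choose C hC using fun j : ZMod N => norm_completedHurwitzZetaEven₀_le (ZMod.toAddCircle j) a b
  refine ⟨∑ j, ‖χ j‖ * C j, fun w h1 h2 => (norm_sum_le _ _).trans ?_⟩
  refine Finset.sum_le_sum fun j _ => ?_
  rw [norm_mul]
  gcongr
  exact hC j w h1 h2

lemma add_mul_I_ne_zero {d : ℝ} (hd : d ≠ 0) (y : ℝ) : (d + y * Complex.I : ℂ) ≠ 0 := by
  intro h
  have := congrArg Complex.re h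
  simp at this
  exact hd this

lemma integral_inv_add_mul_I {d : ℝ} (hd : d ≠ 0) (T : ℝ) :
    ∫ y : ℝ in (-T)..T, (d + y * Complex.I : ℂ)⁻¹ = ((2 * Real.arctan (T / d) : ℝ) : ℂ) := by
  have hder : ∀ y : ℝ, HasDerivAt (fun y : ℝ => ((Real.arctan (y / d) : ℝ) : ℂ) +
      (-(Complex.I / 2)) * ((Real.log (d ^ 2 + y ^ 2) : ℝ) : ℂ)) (d + y * Complex.I : ℂ)⁻¹ y := by
    intro y
    have hpos : 0 < d ^ 2 + y ^ 2 := by positivity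
    have h1 := (((hasDerivAt_id y).div_const d).arctan).ofReal_comp
    have h2 := ((((hasDerivAt_id y).pow 2).const_add (d ^ 2)).log hpos.ne').ofReal_comp
    refine (h1.add (h2.const_mul (-(Complex.I / 2)))).congr_deriv ?_
    have hc : ((d : ℂ) ^ 2 + (y : ℂ) ^ 2) ≠ 0 := by exact_mod_cast hpos.ne'
    have hdc : (d : ℂ) ≠ 0 := by exact_mod_cast hd
    have := add_mul_I_ne_zero hd y
    have hc' : (1 + ((y : ℂ) / d) ^ 2) ≠ 0 := by
      intro h
      apply hc
      have h2 : (d : ℂ) ^ 2 * (1 + ((y : ℂ) / d) ^ 2) = d ^ 2 + y ^ 2 := by field_simp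
      rw [← h2, h, mul_zero]
    refine eq_inv_of_mul_eq_one_left ?_
    simp only [id, Nat.cast_ofNat, Pi.pow_apply]
    push_cast
    have e1 : (1 / (1 + ((y : ℂ) / d) ^ 2) * (1 / d)) = d / (d ^ 2 + y ^ 2) := by
      field_simp
    rw [e1]
    field_simp
    linear_combination (-(y : ℂ) ^ 2) * Complex.I_sq
  rw [intervalIntegral.integral_eq_sub_of_hasDerivAt (fun y _ => hder y)]
  · simp only [neg_div, Real.arctan_neg, even_two, Even.neg_pow]
    push_cast
    ring
  · refine Continuous.intervalIntegrable ?_ _ _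
    exact (by fun_prop : Continuous fun y : ℝ => (d + y * Complex.I : ℂ)).inv₀
      (add_mul_I_ne_zero hd)

lemma integral_inv_sq_add_mul_I {d : ℝ} (hd : d ≠ 0) (T : ℝ) :
    ∫ y : ℝ in (-T)..T, ((d + y * Complex.I : ℂ) ^ 2)⁻¹ =
      Complex.I * ((d + T * Complex.I : ℂ)⁻¹ - (d - T * Complex.I : ℂ)⁻¹) := by
  have hder : ∀ y : ℝ, HasDerivAt (fun y : ℝ => Complex.I * (d + y * Complex.I : ℂ)⁻¹)
      ((d + y * Complex.I : ℂ) ^ 2)⁻¹ y := by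
    intro y
    have h1 : HasDerivAt (fun y : ℝ => (d + y * Complex.I : ℂ)) Complex.I y := by
      simpa using (((hasDerivAt_id y).ofReal_comp).mul_const Complex.I).const_add (d : ℂ)
    refine ((h1.inv (add_mul_I_ne_zero hd y)).const_mul Complex.I).congr_deriv ?_
    rw [mul_div_assoc', mul_neg, Complex.I_mul_I]
    simp
  rw [intervalIntegral.integral_eq_sub_of_hasDerivAt (fun y _ => hder y)]
  · push_cast
    ring
  · refine Continuous.intervalIntegrable ?_ _ _
    exact ((by fun_prop : Continuous fun y : ℝ => (d + y * Complex.I : ℂ)).pow 2).inv₀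
      (fun y => pow_ne_zero 2 (add_mul_I_ne_zero hd y))

lemma tendsto_inv_add_mul_I (d : ℝ) :
    Tendsto (fun T : ℝ => (d + T * Complex.I : ℂ)⁻¹) atTop (nhds 0) := by
  rw [tendsto_zero_iff_norm_tendsto_zero]
  refine squeeze_zero' (.of_forall fun T => norm_nonneg _) ?_ tendsto_inv_atTop_zero
  filter_upwards [eventually_gt_atTop 0] with T hT
  rw [norm_inv]
  gcongr
  have := Complex.abs_im_le_norm (d + T * Complex.I)
  simp at this
  exact (le_abs_self T).trans this

/-- Moving a vertical line of integration across a double pole on the real axis. -/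
lemma integral_vertical_sub_of_double_pole {Q : ℂ → ℂ} (hQ : Differentiable ℂ Q) {σ₀ σ₁ p : ℝ}
    (h₀ : σ₀ < p) (h₁ : p < σ₁) {φ : ℝ → ℝ} (hφ : Tendsto φ atTop (nhds 0))
    (hbd : ∀ w : ℂ, σ₀ ≤ w.re → w.re ≤ σ₁ → 1 ≤ |w.im| → ‖Q w‖ ≤ φ |w.im|)
    (hi₀ : MeasureTheory.Integrable fun τ : ℝ => Q (σ₀ + τ * Complex.I) /
      (σ₀ + τ * Complex.I - p) ^ 2)
    (hi₁ : MeasureTheory.Integrable fun τ : ℝ => Q (σ₁ + τ * Complex.I) /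
      (σ₁ + τ * Complex.I - p) ^ 2) :
    (∫ τ : ℝ, Q (σ₁ + τ * Complex.I) / (σ₁ + τ * Complex.I - p) ^ 2) -
      ∫ τ : ℝ, Q (σ₀ + τ * Complex.I) / (σ₀ + τ * Complex.I - p) ^ 2 = 2 * π * deriv Q p := by
  set R : ℂ → ℂ := dslope (dslope Q p) p with hR
  have hRd : Differentiable ℂ R := by
    have h1 : DifferentiableOn ℂ (dslope Q p) Set.univ :=
      (Complex.differentiableOn_dslope univ_mem).mpr hQ.differentiableOn
    have h2 : DifferentiableOn ℂ R Set.univ := (Complex.differentiableOn_dslope univ_mem).mpr h1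
    exact differentiableOn_univ.mp h2
  have hRe : ∀ w : ℂ, w ≠ p → R w = Q w / (w - p) ^ 2 - Q p * ((w - p) ^ 2)⁻¹
      - deriv Q p * (w - p)⁻¹ := by
    intro w hw
    have hw' : w - p ≠ 0 := sub_ne_zero.mpr hw
    rw [hR, dslope_of_ne _ hw, slope_def_field, dslope_of_ne _ hw, slope_def_field, dslope_same]
    field_simp
  have hvert : ∀ σ : ℝ, σ ≠ p →
      (MeasureTheory.Integrable fun τ : ℝ => Q (σ + τ * Complex.I) /
        (σ + τ * Complex.I - p) ^ 2) →
      ∀ l : ℝ, Tendsto (fun T : ℝ => 2 * Real.arctan (T / (σ - p))) atTop (nhds l) →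
      Tendsto (fun T : ℝ => ∫ y : ℝ in (-T)..T, R (σ + y * Complex.I)) atTop
        (nhds ((∫ τ : ℝ, Q (σ + τ * Complex.I) / (σ + τ * Complex.I - p) ^ 2)
          - deriv Q p * l)) := by
    intro σ hσ hi l hl
    have hd : σ - p ≠ 0 := sub_ne_zero.mpr hσ
    have e : ∀ T : ℝ, ∫ y : ℝ in (-T)..T, R (σ + y * Complex.I) =
        (∫ y : ℝ in (-T)..T, Q (σ + y * Complex.I) / (σ + y * Complex.I - p) ^ 2)
        - Q p * (Complex.I * ((((σ - p : ℝ) : ℂ) + T * Complex.I)⁻¹ -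
          (((σ - p : ℝ) : ℂ) - T * Complex.I)⁻¹))
        - deriv Q p * ((2 * Real.arctan (T / (σ - p)) : ℝ) : ℂ) := by
      intro T
      rw [← integral_inv_sq_add_mul_I hd, ← integral_inv_add_mul_I hd,
        ← intervalIntegral.integral_const_mul, ← intervalIntegral.integral_const_mul]
      have c1 : Continuous fun y : ℝ => (((σ - p : ℝ) : ℂ) + y * Complex.I) := by fun_prop
      rw [← intervalIntegral.integral_sub, ← intervalIntegral.integral_sub]
      · refine intervalIntegral.integral_congr fun y _ => ?_
        have hne := add_mul_I_ne_zero hd y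
        have e2 : (σ + y * Complex.I - p : ℂ) = ((σ - p : ℝ) : ℂ) + y * Complex.I := by
          push_cast; ring
        rw [hRe, e2]
        rw [← sub_ne_zero, e2]
        exact hne
      · exact hi.intervalIntegrable.sub (Continuous.intervalIntegrable (continuous_const.mul
          ((c1.pow 2).inv₀ fun y => pow_ne_zero 2 (add_mul_I_ne_zero hd y))) _ _)
      · exact Continuous.intervalIntegrable (continuous_const.mul
          (c1.inv₀ (add_mul_I_ne_zero hd))) _ _
      · exact hi.intervalIntegrable
      · exact Continuous.intervalIntegrable (continuous_const.mul
          ((c1.pow 2).inv₀ fun y => pow_ne_zero 2 (add_mul_I_ne_zero hd y))) _ _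
    simp_rw [e]
    have t1 := MeasureTheory.intervalIntegral_tendsto_integral hi tendsto_neg_atTop_atBot tendsto_id
    have t2 := tendsto_inv_add_mul_I (σ - p)
    have t3 : Tendsto (fun T : ℝ => (((σ - p : ℝ) : ℂ) - T * Complex.I)⁻¹) atTop (nhds 0) := by
      have := (tendsto_inv_add_mul_I (-(σ - p))).neg
      simp only [neg_zero] at this
      refine this.congr fun T => ?_
      rw [← inv_neg]
      congr 1
      push_cast
      ring
    have t4 := (Complex.continuous_ofReal.tendsto l).comp hl
    have t5 := ((t2.sub t3).const_mul Complex.I).const_mul (Q p)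
    have := (t1.sub t5).sub (t4.const_mul (deriv Q p))
    simpa using this
  have har₁ : Tendsto (fun T : ℝ => 2 * Real.arctan (T / (σ₁ - p))) atTop (nhds π) := by
    have h1 : Tendsto (fun T : ℝ => T / (σ₁ - p)) atTop atTop :=
      tendsto_id.atTop_div_const (by linarith)
    have h2 := ((Real.tendsto_arctan_atTop.mono_right nhdsWithin_le_nhds).comp h1).const_mul 2
    rwa [show 2 * (π / 2) = π by ring] at h2
  have har₀ : Tendsto (fun T : ℝ => 2 * Real.arctan (T / (σ₀ - p))) atTop (nhds (-π)) := by
    have h1 : Tendsto (fun T : ℝ => T / (σ₀ - p)) atTop atBot :=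
      tendsto_id.atTop_div_const_of_neg (by linarith)
    have h2 := ((Real.tendsto_arctan_atBot.mono_right nhdsWithin_le_nhds).comp h1).const_mul 2
    rwa [show 2 * -(π / 2) = -π by ring] at h2
  have v₁ := hvert σ₁ h₁.ne' hi₁ π har₁
  have v₀ := hvert σ₀ h₀.ne hi₀ (-π) har₀
  have hhor : ∀ s : ℝ, |s| = 1 →
      Tendsto (fun T : ℝ => ∫ x : ℝ in σ₀..σ₁, R (x + (s * T : ℝ) * Complex.I)) atTop (nhds 0) := by
    intro s hs
    have hb : Tendsto (fun T : ℝ => (φ T + ‖Q p‖ * T⁻¹ + ‖deriv Q p‖ * T⁻¹) * |σ₁ - σ₀|)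
        atTop (nhds 0) := by
      have := ((hφ.add (tendsto_inv_atTop_zero.const_mul ‖Q p‖)).add
        (tendsto_inv_atTop_zero.const_mul ‖deriv Q p‖)).mul_const |σ₁ - σ₀|
      simpa using this
    refine squeeze_zero_norm' ?_ hb
    filter_upwards [eventually_ge_atTop 1] with T hT
    refine intervalIntegral.norm_integral_le_of_norm_le_const fun x hx => ?_
    rw [Set.uIoc_of_le (by linarith)] at hx
    set w : ℂ := x + (s * T : ℝ) * Complex.I with hw
    have hre : w.re = x := by simp [hw]
    have him : |w.im| = T := by
      simp only [hw, Complex.add_im, Complex.ofReal_im, Complex.mul_im, Complex.ofReal_re,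
        Complex.I_re, Complex.I_im, mul_one, mul_zero, add_zero, zero_add]
      rw [abs_mul, hs, one_mul, abs_of_nonneg (by linarith)]
    have hn : T ≤ ‖w - p‖ := by
      have := Complex.abs_im_le_norm (w - p)
      simp only [Complex.sub_im, Complex.ofReal_im, sub_zero, him] at this
      exact this
    have hne : w ≠ p := by
      rw [← sub_ne_zero, ← norm_pos_iff]; linarith
    rw [hRe w hne]
    have b1 : ‖Q w‖ ≤ φ T := by
      have := hbd w (by rw [hre]; exact hx.1.le) (by rw [hre]; exact hx.2) (by rw [him]; exact hT)
      rwa [him] at this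
    have hT1 : T⁻¹ ≤ 1 := inv_le_one_of_one_le₀ hT
    have i1 : ‖(w - p)⁻¹‖ ≤ T⁻¹ := by
      rw [norm_inv]; gcongr
    have i2 : ‖((w - p) ^ 2)⁻¹‖ ≤ T⁻¹ := by
      rw [← inv_pow, norm_pow]
      nlinarith [norm_nonneg (w - p)⁻¹]
    have n1 : ‖Q w / (w - p) ^ 2‖ ≤ φ T := by
      rw [div_eq_mul_inv, norm_mul]
      calc _ ≤ ‖Q w‖ * 1 := by gcongr; exact i2.trans hT1
        _ ≤ _ := by rwa [mul_one]
    have n2 : ‖Q p * ((w - p) ^ 2)⁻¹‖ ≤ ‖Q p‖ * T⁻¹ := by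
      rw [norm_mul]; gcongr
    have n3 : ‖deriv Q p * (w - p)⁻¹‖ ≤ ‖deriv Q p‖ * T⁻¹ := by
      rw [norm_mul]; gcongr
    have := norm_sub_le (Q w / (w - p) ^ 2 - Q p * ((w - p) ^ 2)⁻¹) (deriv Q p * (w - p)⁻¹)
    have := norm_sub_le (Q w / (w - p) ^ 2) (Q p * ((w - p) ^ 2)⁻¹)
    linarith
  have hrect : ∀ T : ℝ, (∫ x : ℝ in σ₀..σ₁, R (x + ((-1) * T : ℝ) * Complex.I)) -
      (∫ x : ℝ in σ₀..σ₁, R (x + (1 * T : ℝ) * Complex.I)) +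
      Complex.I * (∫ y : ℝ in (-T)..T, R (σ₁ + y * Complex.I)) -
      Complex.I * (∫ y : ℝ in (-T)..T, R (σ₀ + y * Complex.I)) = 0 := by
    intro T
    have := Complex.integral_boundary_rect_eq_zero_of_differentiableOn R
      (σ₀ + (-T : ℝ) * Complex.I) (σ₁ + (T : ℝ) * Complex.I) hRd.differentiableOn
    simpa using this
  have hlim := ((((hhor (-1) (by simp)).sub (hhor 1 (by simp))).add
    (v₁.const_mul Complex.I)).sub (v₀.const_mul Complex.I))
  have h0 := tendsto_nhds_unique (hlim.congr hrect) tendsto_const_nhds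
  push_cast at h0
  have hI : Complex.I * Complex.I = -1 := Complex.I_mul_I
  linear_combination (-Complex.I) * h0 - (((∫ τ : ℝ, Q (σ₁ + τ * Complex.I) / (σ₁ + τ * Complex.I - p) ^ 2) -
      ∫ τ : ℝ, Q (σ₀ + τ * Complex.I) / (σ₀ + τ * Complex.I - p) ^ 2) - 2 * π * deriv Q p) * (-hI)

section DirichletSeries

variable {N : ℕ} (χ : DirichletCharacter ℂ N)

lemma scrD_zero : scrD χ 0 = 0 := by simp [scrD]

lemma scrD_eq_convolution :
    scrD χ = LSeries.convolution (LSeries.convolution (fun n => χ (n : ZMod N)) 1) 1 := by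
  have h : ∀ f : ℕ → ℂ, ∀ n, LSeries.convolution f 1 n = ∑ k ∈ n.divisors, f k := by
    intro f n
    rw [LSeries.convolution_def]
    simpa using Nat.sum_divisorsAntidiagonal (n := n) (fun i _ => f i)
  funext n
  rw [h, scrD]
  exact Finset.sum_congr rfl fun k _ => by rw [h, divisorSumChar]

lemma LSeriesSummable_scrD {s : ℂ} (hs : 1 < s.re) : LSeriesSummable (scrD χ) s := by
  rw [scrD_eq_convolution]
  exact ((DirichletCharacter.LSeriesSummable_of_one_lt_re χ hs).convolution
    (LSeriesSummable_one_iff.mpr hs)).convolution (LSeriesSummable_one_iff.mpr hs)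

lemma LSeries_scrD [NeZero N] {s : ℂ} (hs : 1 < s.re) :
    LSeries (scrD χ) s = χ.LFunction s * riemannZeta s ^ 2 := by
  have h1 := DirichletCharacter.LSeriesSummable_of_one_lt_re χ hs
  have h2 := LSeriesSummable_one_iff.mpr hs
  rw [scrD_eq_convolution, LSeries_convolution' (h1.convolution h2) h2,
    LSeries_convolution' h1 h2, LSeries_one_eq_riemannZeta hs, χ.LFunction_eq_LSeries hs]
  ring

lemma LSeries_term_scrD (s : ℂ) (n : ℕ) :
    LSeries.term (scrD χ) s n = scrD χ n * (n : ℂ) ^ (-s) := by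
  rcases eq_or_ne n 0 with rfl | hn
  · simp [scrD_zero]
  · rw [LSeries.term_of_ne_zero hn, Complex.cpow_neg, div_eq_mul_inv]

lemma summable_norm_scrD_mul_rpow {σ : ℝ} (hσ : 1 < σ) :
    Summable fun n : ℕ => ‖scrD χ n‖ * (n : ℝ) ^ (-σ) := by
  have h := (LSeriesSummable_scrD χ (s := σ) (by simpa using hσ)).norm
  refine h.congr fun n => ?_
  rw [LSeries_term_scrD, norm_mul]
  rcases eq_or_ne n 0 with rfl | hn
  · simp [scrD_zero]
  · have hn : (0 : ℝ) < n := by exact_mod_cast Nat.pos_of_ne_zero hn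
    rw [← Complex.ofReal_natCast, Complex.norm_cpow_eq_rpow_re_of_pos hn]
    simp

end DirichletSeries

section RieszKernel

variable {ρ : ℝ}

lemma norm_betaIntegral_le (u v : ℂ) :
    ‖Complex.betaIntegral u v‖ ≤ ‖Complex.betaIntegral u.re v.re‖ := by
  have key : ∀ a b : ℂ, ∀ t ∈ Set.Ioo (0 : ℝ) 1,
      ‖(t : ℂ) ^ (a - 1) * (1 - (t : ℂ)) ^ (b - 1)‖ =
        t ^ (a.re - 1) * (1 - t) ^ (b.re - 1) := by
    intro a b t ht
    rw [norm_mul, Complex.norm_cpow_eq_rpow_re_of_pos ht.1,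
      show (1 - (t : ℂ)) = ((1 - t : ℝ) : ℂ) by push_cast; rfl,
      Complex.norm_cpow_eq_rpow_re_of_pos (by linarith [ht.2])]
    simp
  have hb : Complex.betaIntegral u.re v.re =
      ((∫ t in (0 : ℝ)..1, t ^ (u.re - 1) * (1 - t) ^ (v.re - 1) : ℝ) : ℂ) := by
    rw [Complex.betaIntegral, ← intervalIntegral.integral_ofReal]
    refine intervalIntegral.integral_congr fun t ht => ?_
    rw [Set.uIcc_of_le zero_le_one] at ht
    have h1 : (0 : ℝ) ≤ 1 - t := by linarith [ht.2]
    push_cast [Complex.ofReal_cpow ht.1, Complex.ofReal_cpow h1]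
    rfl
  have hnn : 0 ≤ ∫ t in (0 : ℝ)..1, t ^ (u.re - 1) * (1 - t) ^ (v.re - 1) := by
    refine intervalIntegral.integral_nonneg zero_le_one fun t ht => ?_
    have h1 : (0 : ℝ) ≤ 1 - t := by linarith [ht.2]
    have := ht.1
    positivity
  rw [hb, Complex.norm_real, Real.norm_of_nonneg hnn, Complex.betaIntegral]
  refine (intervalIntegral.norm_integral_le_integral_norm zero_le_one).trans (le_of_eq ?_)
  rw [intervalIntegral.integral_of_le zero_le_one, intervalIntegral.integral_of_le zero_le_one,
    MeasureTheory.integral_Ioc_eq_integral_Ioo, MeasureTheory.integral_Ioc_eq_integral_Ioo]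
  exact MeasureTheory.setIntegral_congr_fun measurableSet_Ioo fun t ht => key u v t ht

/-- The Mellin transform of `v ↦ (1 - v)₊ ^ ρ / Γ(ρ + 1)`. -/
noncomputable def rieszKernel (ρ : ℝ) (w : ℂ) : ℂ :=
  Complex.Gamma w * (Complex.Gamma (w + ρ + 1))⁻¹

lemma exists_norm_rieszKernel_le (hρ : 1 < ρ) :
    ∃ C, 0 ≤ C ∧ ∀ τ : ℝ, ‖rieszKernel ρ (1 + τ * Complex.I)‖ ≤ C * (1 + τ ^ 2)⁻¹ := by
  refine ⟨‖(Complex.Gamma (ρ - 1 : ℝ))⁻¹‖ * ‖Complex.betaIntegral (3 : ℝ) (ρ - 1 : ℝ)‖,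
    by positivity, fun τ => ?_⟩
  set w : ℂ := 1 + τ * Complex.I with hw
  have hre : w.re = 1 := by simp [hw]
  have hw0 : w ≠ 0 := fun h => by simp [h] at hre
  have hw1 : w + 1 ≠ 0 := fun h => by
    have := congrArg Complex.re h
    norm_num [hre] at this
  have hb := Complex.Gamma_mul_Gamma_eq_betaIntegral (s := w + 2) (t := (ρ - 1 : ℝ))
    (by simp [hre]; norm_num) (by simp; linarith)
  have hG : Complex.Gamma (w + 2) = (w + 1) * (w * Complex.Gamma w) := by
    rw [← Complex.Gamma_add_one w hw0, ← Complex.Gamma_add_one (w + 1) hw1]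
    ring_nf
  have hs : w + 2 + (ρ - 1 : ℝ) = w + ρ + 1 := by push_cast; ring
  rw [hs, hG] at hb
  have hG1 : Complex.Gamma (w + ρ + 1) ≠ 0 :=
    Complex.Gamma_ne_zero_of_re_pos (by simp [hre]; linarith)
  have hG2 : Complex.Gamma (ρ - 1 : ℝ) ≠ 0 :=
    Complex.Gamma_ne_zero_of_re_pos (by simp; linarith)
  have e : rieszKernel ρ w = (Complex.Gamma (ρ - 1 : ℝ))⁻¹ *
      Complex.betaIntegral (w + 2) (ρ - 1 : ℝ) * ((w + 1) * w)⁻¹ := by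
    rw [rieszKernel]
    field_simp
    linear_combination hb
  have n1 := norm_betaIntegral_le (w + 2) (ρ - 1 : ℝ)
  have hr : (w + 2).re = 3 := by simp [hre]; norm_num
  rw [hr, Complex.ofReal_re] at n1
  rw [e, norm_mul, norm_mul]
  gcongr
  rw [norm_inv]
  gcongr
  rw [norm_mul]
  have a1 : 1 + τ ^ 2 = ‖w‖ * ‖w‖ := by
    rw [Complex.norm_mul_self_eq_normSq, Complex.normSq_apply]; simp [hw]; ring
  have a2 : ‖w‖ ^ 2 ≤ ‖w + 1‖ ^ 2 := by
    rw [Complex.sq_norm, Complex.sq_norm, Complex.normSq_apply, Complex.normSq_apply]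
    simp [hw]
    norm_num
  have a3 := abs_le_of_sq_le_sq' a2 (norm_nonneg _)
  rw [a1]
  gcongr
  exact a3.2

lemma continuous_rieszKernel (ρ : ℝ) :
    Continuous fun τ : ℝ => rieszKernel ρ (1 + τ * Complex.I) := by
  refine Continuous.mul ?_ ?_
  · refine continuous_iff_continuousAt.mpr fun τ => ?_
    refine ContinuousAt.comp (g := Complex.Gamma) ?_ (by fun_prop)
    refine (Complex.differentiableAt_Gamma _ fun m h => ?_).continuousAt
    have := congrArg Complex.re h
    simp at this
    have : (0 : ℝ) ≤ m := m.cast_nonneg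
    linarith
  · exact Complex.differentiable_one_div_Gamma.continuous.comp (by fun_prop)

lemma integrable_rieszKernel (hρ : 1 < ρ) :
    MeasureTheory.Integrable fun τ : ℝ => rieszKernel ρ (1 + τ * Complex.I) := by
  obtain ⟨C, hC, h⟩ := exists_norm_rieszKernel_le hρ
  refine (integrable_inv_one_add_sq.const_mul C).mono' (continuous_rieszKernel ρ).aestronglyMeasurable
    (.of_forall h)

lemma mellin_one_sub_rpow (hρ : 1 < ρ) {w : ℂ} (hw : 0 < w.re) :
    HasMellin (fun v : ℝ => (((max (1 - v) 0) ^ ρ / Real.Gamma (ρ + 1) : ℝ) : ℂ)) w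
      (rieszKernel ρ w) := by
  have hG1 : Complex.Gamma (ρ + 1) ≠ 0 :=
    Complex.Gamma_ne_zero_of_re_pos (by simp; linarith)
  have hG2 : Complex.Gamma (w + (ρ + 1)) ≠ 0 :=
    Complex.Gamma_ne_zero_of_re_pos (by simp; linarith)
  have heq : Set.EqOn (fun v : ℝ => (v : ℂ) ^ (w - 1) •
      (((max (1 - v) 0) ^ ρ / Real.Gamma (ρ + 1) : ℝ) : ℂ))
      (fun v : ℝ => (v : ℂ) ^ (w - 1) * (1 - (v : ℂ)) ^ ((ρ : ℂ) + 1 - 1) *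
        (Complex.Gamma (ρ + 1))⁻¹) (Set.Ioc 0 1) := by
    intro v hv
    have h1 : 0 ≤ 1 - v := by linarith [hv.2]
    simp only [max_eq_left h1, smul_eq_mul]
    push_cast [Complex.ofReal_cpow h1, ← Complex.Gamma_ofReal]
    rw [add_sub_cancel_right, mul_assoc, div_eq_mul_inv]
  have hzero : ∀ v ∈ Set.Ioi (0 : ℝ) \ Set.Ioc 0 1, (v : ℂ) ^ (w - 1) •
      (((max (1 - v) 0) ^ ρ / Real.Gamma (ρ + 1) : ℝ) : ℂ) = 0 := by
    intro v hv
    have h1 : 1 < v := by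
      by_contra h
      exact hv.2 ⟨hv.1, not_lt.mp h⟩
    rw [max_eq_right (by linarith), Real.zero_rpow (by linarith)]
    simp
  have hconv := (Complex.betaIntegral_convergent (u := w) (v := ρ + 1) hw
    (by simp; linarith)).mul_const (Complex.Gamma (ρ + 1))⁻¹
  rw [intervalIntegrable_iff_integrableOn_Ioc_of_le zero_le_one] at hconv
  constructor
  · refine MeasureTheory.IntegrableOn.of_forall_sdiff_eq_zero
      (hconv.congr_fun heq.symm measurableSet_Ioc) measurableSet_Ioi hzero
  · rw [mellin, MeasureTheory.setIntegral_eq_of_subset_of_forall_sdiff_eq_zero measurableSet_Ioi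
      (fun v hv => hv.1) hzero, MeasureTheory.setIntegral_congr_fun measurableSet_Ioc heq,
      ← intervalIntegral.integral_of_le zero_le_one, intervalIntegral.integral_mul_const]
    have := Complex.betaIntegral_eq_Gamma_mul_div w (ρ + 1) hw (by simp; linarith)
    rw [Complex.betaIntegral] at this
    rw [this, rieszKernel, add_assoc]
    field_simp

lemma integral_rieszKernel_mul_cpow (hρ : 1 < ρ) {v : ℝ} (hv : 0 < v) :
    ∫ τ : ℝ, rieszKernel ρ (1 + τ * Complex.I) * (v : ℂ) ^ (-(1 + τ * Complex.I)) =
      2 * π * (((max (1 - v) 0) ^ ρ / Real.Gamma (ρ + 1) : ℝ) : ℂ) := by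
  have hm : ∀ τ : ℝ, mellin (fun v : ℝ => (((max (1 - v) 0) ^ ρ / Real.Gamma (ρ + 1) : ℝ) : ℂ))
      ((1 : ℝ) + τ * Complex.I) = rieszKernel ρ (1 + τ * Complex.I) := fun τ => by
    rw [(mellin_one_sub_rpow hρ (by simp)).2, Complex.ofReal_one]
  have h := mellinInv_mellin_eq 1
    (fun v : ℝ => (((max (1 - v) 0) ^ ρ / Real.Gamma (ρ + 1) : ℝ) : ℂ)) hv
    (mellin_one_sub_rpow hρ (by simp)).1 (by
      rw [Complex.VerticalIntegrable]
      simp_rw [hm]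
      exact integrable_rieszKernel hρ) (by
      have : Continuous fun v : ℝ => (max (1 - v) 0) ^ ρ / Real.Gamma (ρ + 1) :=
        (Continuous.rpow_const (by fun_prop) fun v => Or.inr (by linarith)).div_const _
      exact (Complex.continuous_ofReal.comp this).continuousAt)
  rw [← h, mellinInv]
  simp_rw [hm]
  rw [Complex.real_smul]
  push_cast
  have hπ : (π : ℂ) ≠ 0 := by exact_mod_cast Real.pi_ne_zero
  rw [← mul_assoc, mul_one_div_cancel (by simp), one_mul]
  exact MeasureTheory.integral_congr_ae (.of_forall fun τ => by
    simp only [smul_eq_mul]; rw [mul_comm])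

end RieszKernel

lemma norm_cexp_mul_sq_vertical (ε σ τ : ℝ) :
    ‖Complex.exp (ε * (σ + τ * Complex.I) ^ 2)‖ = Real.exp (ε * σ ^ 2 - ε * τ ^ 2) := by
  rw [Complex.norm_exp]
  congr 1
  simp [pow_two]
  ring

lemma integrable_vertical_mul_gaussian {P : ℂ → ℂ} (hP : Continuous P)
    (hb : ExpBoundedOnStrips P) {σ p ε : ℝ} (hσ : σ ≠ p) (hε : 0 < ε) :
    MeasureTheory.Integrable fun τ : ℝ =>
      P (σ + τ * Complex.I) * Complex.exp (ε * (σ + τ * Complex.I) ^ 2) /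
        (σ + τ * Complex.I - p) ^ 2 := by
  obtain ⟨C, c, hC, hc, h⟩ := hb σ σ
  have hne : ∀ τ : ℝ, (σ + τ * Complex.I - p : ℂ) ^ 2 ≠ 0 := by
    intro τ
    have := add_mul_I_ne_zero (sub_ne_zero.mpr hσ) τ
    rw [show (σ + τ * Complex.I - p : ℂ) = ((σ - p : ℝ) : ℂ) + τ * Complex.I by push_cast; ring]
    exact pow_ne_zero 2 this
  set g : ℝ → ℂ := fun τ => P (σ + τ * Complex.I) *
    Complex.exp (ε * (σ + τ * Complex.I) ^ 2) / (σ + τ * Complex.I - p) ^ 2 with hg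
  have hgc : Continuous g := by
    refine Continuous.div ?_ (by fun_prop) hne
    exact (hP.comp (by fun_prop)).mul (by fun_prop)
  set G : ℝ → ℂ := fun τ => g τ * (Real.exp (ε / 2 * τ ^ 2) : ℂ) with hG
  have hGc : Continuous G := hgc.mul (by fun_prop)
  obtain ⟨B, hB⟩ := (isCompact_Icc (a := (-1 : ℝ)) (b := 1)).exists_bound_of_continuousOn
    hGc.continuousOn
  have hbound : ∀ τ, ‖G τ‖ ≤ max B (C * Real.exp (ε * σ ^ 2 + c ^ 2 / (2 * ε))) := by
    intro τ
    rcases le_total |τ| 1 with h1 | h1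
    · exact (hB τ (abs_le.mp h1)).trans (le_max_left _ _)
    · refine le_trans ?_ (le_max_right _ _)
      have h2 := h (σ + τ * Complex.I) (by simp) (by simp) (by simpa using h1)
      have him : (σ + τ * Complex.I : ℂ).im = τ := by simp
      rw [him] at h2
      have h3 : 1 ≤ ‖(σ + τ * Complex.I - p : ℂ) ^ 2‖ := by
        have := Complex.abs_im_le_norm (σ + τ * Complex.I - p : ℂ)
        rw [show (σ + τ * Complex.I - p : ℂ).im = τ by simp] at this
        rw [norm_pow]
        exact one_le_pow₀ (h1.trans this)
      have h4 : 0 < 2 * ε := by positivity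
      have h5 : c * |τ| + (ε * σ ^ 2 - ε * τ ^ 2) + ε / 2 * τ ^ 2 ≤
          ε * σ ^ 2 + c ^ 2 / (2 * ε) := by
        have : c * |τ| - ε / 2 * τ ^ 2 ≤ c ^ 2 / (2 * ε) := by
          rw [le_div_iff₀ h4, ← sq_abs τ]
          nlinarith [sq_nonneg (ε * |τ| - c)]
        linarith
      simp only [hG, hg]
      rw [norm_mul, norm_div, norm_mul, norm_cexp_mul_sq_vertical, Complex.norm_real,
        Real.norm_of_nonneg (Real.exp_pos _).le]
      calc _ ≤ (C * Real.exp (c * |τ|) * Real.exp (ε * σ ^ 2 - ε * τ ^ 2)) / 1 *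
            Real.exp (ε / 2 * τ ^ 2) := by gcongr
        _ = C * Real.exp (c * |τ| + (ε * σ ^ 2 - ε * τ ^ 2) + ε / 2 * τ ^ 2) := by
            rw [Real.exp_add, Real.exp_add]; ring
        _ ≤ _ := by gcongr
  have := integrable_mul_gaussian hGc hbound (half_pos hε)
  refine this.congr (.of_forall fun τ => ?_)
  simp only [hG]
  rw [mul_assoc, ← Complex.ofReal_mul, ← Real.exp_add]
  simp

lemma integral_vertical_mul_gaussian_sub {P : ℂ → ℂ} (hP : Differentiable ℂ P)
    (hb : ExpBoundedOnStrips P) {σ₀ σ₁ p : ℝ} (h₀ : σ₀ < p) (h₁ : p < σ₁) {ε : ℝ} (hε : 0 < ε) :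
    (∫ τ : ℝ, P (σ₁ + τ * Complex.I) * Complex.exp (ε * (σ₁ + τ * Complex.I) ^ 2) /
        (σ₁ + τ * Complex.I - p) ^ 2) -
      (∫ τ : ℝ, P (σ₀ + τ * Complex.I) * Complex.exp (ε * (σ₀ + τ * Complex.I) ^ 2) /
        (σ₀ + τ * Complex.I - p) ^ 2) =
      2 * π * ((deriv P p + P p * (2 * ε * p)) * Complex.exp (ε * p ^ 2)) := by
  obtain ⟨C, c, hC, hc, h⟩ := hb σ₀ σ₁
  have hQ : Differentiable ℂ fun w => P w * Complex.exp (ε * w ^ 2) := by fun_prop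
  have hd : deriv (fun w => P w * Complex.exp (ε * w ^ 2)) p =
      (deriv P p + P p * (2 * ε * p)) * Complex.exp (ε * p ^ 2) := by
    have h1 : HasDerivAt (fun w : ℂ => (ε : ℂ) * w ^ 2) (ε * (2 * p)) (p : ℂ) := by
      simpa using (hasDerivAt_pow 2 (p : ℂ)).const_mul (ε : ℂ)
    have := ((hP p).hasDerivAt.mul h1.cexp).deriv
    rw [show (fun w => P w * Complex.exp (ε * w ^ 2)) =
      P * fun w => Complex.exp (ε * w ^ 2) from rfl, this]
    ring
  rw [← hd]
  set S : ℝ := σ₀ ^ 2 + σ₁ ^ 2 with hS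
  refine integral_vertical_sub_of_double_pole hQ h₀ h₁
    (φ := fun t => C * Real.exp (ε * S) * Real.exp (c * t - ε * t ^ 2)) ?_ ?_
    (integrable_vertical_mul_gaussian hP.continuous hb h₀.ne hε)
    (integrable_vertical_mul_gaussian hP.continuous hb h₁.ne' hε)
  · have h1 : Tendsto (fun t : ℝ => c * t - ε * t ^ 2) atTop atBot := by
      have h2 : Tendsto (fun t : ℝ => t * (c - ε * t)) atTop atBot := by
        refine tendsto_id.atTop_mul_atBot₀ ?_
        exact tendsto_atBot_add_const_left _ c
          (tendsto_neg_atTop_atBot.comp (tendsto_id.const_mul_atTop hε))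
      refine h2.congr fun t => by ring
    have := (Real.tendsto_exp_atBot.comp h1).const_mul (C * Real.exp (ε * S))
    simpa using this
  · intro w hw1 hw2 hw3
    have h1 := h w hw1 hw2 hw3
    have h2 : ‖Complex.exp (ε * w ^ 2)‖ = Real.exp (ε * w.re ^ 2 - ε * w.im ^ 2) := by
      rw [← norm_cexp_mul_sq_vertical, Complex.re_add_im]
    have h3 : w.re ^ 2 ≤ S := by
      rw [hS]
      rcases le_total 0 w.re with h | h
      · nlinarith [sq_nonneg σ₀]
      · nlinarith [sq_nonneg σ₁]
    rw [norm_mul, h2, sq_abs]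
    calc _ ≤ (C * Real.exp (c * |w.im|)) * Real.exp (ε * S - ε * w.im ^ 2) := by
          gcongr
      _ = _ := by
          rw [mul_assoc, mul_assoc, ← Real.exp_add, ← Real.exp_add]
          ring_nf

/-- Contour shift across a double pole with Gaussian regularisation of the shifted integral. -/
lemma norm_integral_vertical_sub_le {P : ℂ → ℂ} (hP : Differentiable ℂ P)
    (hb : ExpBoundedOnStrips P) {σ₀ σ₁ p : ℝ} (h₀ : σ₀ < p) (h₁ : p < σ₁)
    (hi : MeasureTheory.Integrable fun τ : ℝ => P (σ₁ + τ * Complex.I) /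
      (σ₁ + τ * Complex.I - p) ^ 2) {B : ℝ}
    (hB : ∀ ε : ℝ, 0 < ε → ε ≤ 1 → ‖∫ τ : ℝ, P (σ₀ + τ * Complex.I) *
      Complex.exp (ε * (σ₀ + τ * Complex.I) ^ 2) / (σ₀ + τ * Complex.I - p) ^ 2‖ ≤ B) :
    ‖(∫ τ : ℝ, P (σ₁ + τ * Complex.I) / (σ₁ + τ * Complex.I - p) ^ 2) -
      2 * π * deriv P p‖ ≤ B := by
  have hev : ∀ᶠ ε : ℝ in nhdsWithin 0 (Set.Ioi 0), 0 < ε ∧ ε ≤ 1 := by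
    filter_upwards [Ioc_mem_nhdsGT (zero_lt_one' ℝ)] with ε hε
    exact hε
  have lim1 : Tendsto (fun ε : ℝ => ∫ τ : ℝ, P (σ₁ + τ * Complex.I) *
      Complex.exp (ε * (σ₁ + τ * Complex.I) ^ 2) / (σ₁ + τ * Complex.I - p) ^ 2)
      (nhdsWithin 0 (Set.Ioi 0))
      (nhds (∫ τ : ℝ, P (σ₁ + τ * Complex.I) / (σ₁ + τ * Complex.I - p) ^ 2)) := by
    refine MeasureTheory.tendsto_integral_filter_of_dominated_convergence
      (fun τ => Real.exp (σ₁ ^ 2) * ‖P (σ₁ + τ * Complex.I) / (σ₁ + τ * Complex.I - p) ^ 2‖)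
      ?_ ?_ (hi.norm.const_mul _) ?_
    · filter_upwards [hev] with ε hε
      exact (integrable_vertical_mul_gaussian hP.continuous hb h₁.ne' hε.1).aestronglyMeasurable
    · filter_upwards [hev] with ε hε
      refine .of_forall fun τ => ?_
      rw [mul_div_right_comm, norm_mul, mul_comm, norm_cexp_mul_sq_vertical]
      gcongr
      nlinarith [sq_nonneg τ, sq_nonneg σ₁, mul_nonneg hε.1.le (sq_nonneg τ)]
    · refine .of_forall fun τ => Tendsto.mono_left ?_ nhdsWithin_le_nhds
      have : Continuous fun ε : ℝ => P (σ₁ + τ * Complex.I) *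
          Complex.exp (ε * (σ₁ + τ * Complex.I) ^ 2) / (σ₁ + τ * Complex.I - p) ^ 2 := by
        fun_prop
      simpa using this.tendsto 0
  have lim2 : Tendsto (fun ε : ℝ => 2 * π * ((deriv P p + P p * (2 * ε * p)) *
      Complex.exp (ε * p ^ 2))) (nhdsWithin 0 (Set.Ioi 0)) (nhds (2 * π * deriv P p)) := by
    refine Tendsto.mono_left ?_ nhdsWithin_le_nhds
    have : Continuous fun ε : ℝ => 2 * π * ((deriv P p + P p * (2 * ε * p)) *
      Complex.exp (ε * p ^ 2)) := by fun_prop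
    simpa using this.tendsto 0
  refine le_of_tendsto (lim1.sub lim2).norm ?_
  filter_upwards [hev] with ε hε
  rw [← integral_vertical_mul_gaussian_sub hP hb h₀ h₁ hε.1, sub_sub_cancel]
  exact hB ε hε.1 hε.2

/-- The entire function `(2 w - 1) ζ(2 w)`. -/
noncomputable def zetaEntire (w : ℂ) : ℂ :=
  (π : ℂ) ^ w * ((2 * w * (2 * w - 1) * completedRiemannZeta₀ (2 * w) + 1) / 2) *
    (Complex.Gamma (w + 1))⁻¹

lemma zetaEntire_eq {w : ℂ} (h0 : w ≠ 0) (h1 : w ≠ 1 / 2) :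
    zetaEntire w = (2 * w - 1) * riemannZeta (2 * w) := by
  have h1' : (2 * w - 1) ≠ 0 := fun h => h1 (by linear_combination h / 2)
  have h1'' : (1 - 2 * w) ≠ 0 := fun h => h1' (by linear_combination -h)
  have hπ : (π : ℂ) ≠ 0 := by exact_mod_cast Real.pi_ne_zero
  rw [riemannZeta_def_of_ne_zero (by simpa using h0), completedRiemannZeta_eq, zetaEntire,
    Complex.Gammaℝ_def, Complex.Gamma_add_one _ h0]
  have e1 : -(2 * w) / 2 = -w := by ring
  have e2 : 2 * w / 2 = w := by ring
  rw [e1, e2, Complex.cpow_neg]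
  have hp : (π : ℂ) ^ w ≠ 0 := by simp [Complex.cpow_eq_zero_iff, hπ]
  simp only [mul_inv, div_eq_mul_inv, inv_inv]
  field_simp
  ring

lemma differentiable_zetaEntire : Differentiable ℂ zetaEntire := by
  have hπ : (π : ℂ) ≠ 0 := by exact_mod_cast Real.pi_ne_zero
  unfold zetaEntire
  refine ((Differentiable.const_cpow differentiable_id (Or.inl hπ)).mul ?_).mul
    (Complex.differentiable_one_div_Gamma.comp (differentiable_id.add_const 1))
  have := differentiable_completedZeta₀.comp (differentiable_id.const_mul (2 : ℂ))
  have h2 : Differentiable ℂ fun w => completedRiemannZeta₀ (2 * w) := this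
  fun_prop

lemma expBoundedOnStrips_zetaEntire : ExpBoundedOnStrips zetaEntire := by
  have hz := expBoundedOnStrips_completedRiemannZeta₀.comp_mul_add (r := 2) (by norm_num) 0
  have hp := ExpBoundedOnStrips.cpow_const Real.pi_pos 1
  have hG := ExpBoundedOnStrips.inv_Gamma.comp_mul_add (r := 1) le_rfl 1
  have h2 := (ExpBoundedOnStrips.const 2).mul ExpBoundedOnStrips.id
  have h3 := h2.add (ExpBoundedOnStrips.const (-1))
  have h4 := (((h2.mul h3).mul hz).add (ExpBoundedOnStrips.const 1)).mul
    (ExpBoundedOnStrips.const (1 / 2))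
  refine (congrArg ExpBoundedOnStrips (funext fun w => ?_)).mp ((hp.mul h4).mul hG)
  simp only [zetaEntire, Complex.ofReal_one, Complex.ofReal_zero, one_mul, add_zero,
    Complex.ofReal_ofNat]
  ring

/-- The function `(w - 1/2)² Γ(w) / Γ(w + ρ + 1) L(2w, χ) ζ(2w)² x^(2w)`, continued to `ℂ`. -/
noncomputable def perronNumerator {N : ℕ} [NeZero N] (χ : DirichletCharacter ℂ N) (ρ x : ℝ)
    (w : ℂ) : ℂ :=
  (π : ℂ) ^ w * χ.completedLFunction (2 * w) * zetaEntire w ^ 2 * (1 / 4) *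
    (Complex.Gamma (w + ρ + 1))⁻¹ * (x : ℂ) ^ (2 * w)

section PerronIntegral

variable {N : ℕ} [NeZero N] {χ : DirichletCharacter ℂ N} {ρ x : ℝ}

lemma differentiable_perronNumerator (hχ : χ ≠ 1) (ρ : ℝ) (hx : 0 < x) :
    Differentiable ℂ (perronNumerator χ ρ x) := by
  have hπ : (π : ℂ) ≠ 0 := by exact_mod_cast Real.pi_ne_zero
  have hx' : (x : ℂ) ≠ 0 := by exact_mod_cast hx.ne'
  have hL : Differentiable ℂ fun w => χ.completedLFunction (2 * w) :=
    (DirichletCharacter.differentiable_completedLFunction hχ).comp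
      (differentiable_id.const_mul (2 : ℂ))
  have hG : Differentiable ℂ fun w => (Complex.Gamma (w + ρ + 1))⁻¹ :=
    Complex.differentiable_one_div_Gamma.comp ((differentiable_id.add_const (ρ : ℂ)).add_const 1)
  exact (((((Differentiable.const_cpow differentiable_id (Or.inl hπ)).mul hL).mul
    (differentiable_zetaEntire.pow 2)).mul_const _).mul hG).mul
    (Differentiable.const_cpow (differentiable_id.const_mul (2 : ℂ)) (Or.inl hx'))

lemma expBoundedOnStrips_perronNumerator (hN : N ≠ 1) (heven : χ.Even) (hχ : χ ≠ 1) (ρ : ℝ)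
    (hx : 0 < x) : ExpBoundedOnStrips (perronNumerator χ ρ x) := by
  have hL := (expBoundedOnStrips_completedLFunction heven hχ hN).comp_mul_add (r := 2)
    (by norm_num) 0
  have hp := ExpBoundedOnStrips.cpow_const Real.pi_pos 1
  have hG := ExpBoundedOnStrips.inv_Gamma.comp_mul_add (r := 1) le_rfl (ρ + 1)
  have hX := ExpBoundedOnStrips.cpow_const hx 2
  refine (congrArg ExpBoundedOnStrips (funext fun w => ?_)).mp
    (((((hp.mul hL).mul (expBoundedOnStrips_zetaEntire.pow 2)).mul
      (ExpBoundedOnStrips.const (1 / 4))).mul hG).mul hX)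
  simp only [perronNumerator, Complex.ofReal_one, Complex.ofReal_zero, one_mul, add_zero,
    Complex.ofReal_ofNat, Complex.ofReal_add, add_assoc]

lemma perronNumerator_div_sq {w : ℂ} (h0 : w ≠ 0) (h1 : w ≠ 1 / 2) :
    perronNumerator χ ρ x w / (w - ((1 / 2 : ℝ) : ℂ)) ^ 2 =
      (π : ℂ) ^ w * χ.completedLFunction (2 * w) * riemannZeta (2 * w) ^ 2 *
        (Complex.Gamma (w + ρ + 1))⁻¹ * (x : ℂ) ^ (2 * w) := by
  have h1' : (w - ((1 / 2 : ℝ) : ℂ)) ≠ 0 := by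
    push_cast
    exact sub_ne_zero.mpr h1
  rw [perronNumerator, zetaEntire_eq h0 h1, div_eq_iff (pow_ne_zero 2 h1')]
  push_cast
  ring

lemma completedLFunction_two_mul (heven : χ.Even) {w : ℂ} (hw : 0 < w.re) :
    χ.completedLFunction (2 * w) =
      χ.LFunction (2 * w) * (π : ℂ) ^ (-w) * Complex.Gamma w := by
  have h0 : (2 * w) ≠ 0 := by
    intro h
    have : w = 0 := by simpa using h
    simp [this] at hw
  have hG := DirichletCharacter.LFunction_eq_completed_div_gammaFactor χ (2 * w) (Or.inl h0)
  have e1 : -(2 * w) / 2 = -w := by ring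
  have e2 : 2 * w / 2 = w := by ring
  rw [heven.gammaFactor_def] at hG
  rw [hG, mul_assoc, ← show Complex.Gammaℝ (2 * w) = (π : ℂ) ^ (-w) * Complex.Gamma w by
    rw [Complex.Gammaℝ_def, e1, e2], div_mul_cancel₀]
  exact Complex.Gammaℝ_ne_zero_of_re_pos (by simpa using hw)

lemma perronNumerator_div_sq_line_one (heven : χ.Even) (hx : 0 < x) (τ : ℝ) :
    perronNumerator χ ρ x (1 + τ * Complex.I) / (1 + τ * Complex.I - ((1 / 2 : ℝ) : ℂ)) ^ 2 =
      ∑' n : ℕ, scrD χ n * (rieszKernel ρ (1 + τ * Complex.I) *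
        ((((n : ℝ) / x) ^ 2 : ℝ) : ℂ) ^ (-(1 + τ * Complex.I))) := by
  set w : ℂ := 1 + τ * Complex.I with hw
  have hre : w.re = 1 := by simp [hw]
  have h0 : w ≠ 0 := fun h => by simp [h] at hre
  have h1 : w ≠ 1 / 2 := fun h => by rw [h] at hre; norm_num at hre
  have hπ : (π : ℂ) ≠ 0 := by exact_mod_cast Real.pi_ne_zero
  have hp : (π : ℂ) ^ w ≠ 0 := by simp [Complex.cpow_eq_zero_iff, hπ]
  have hs : 1 < (2 * w).re := by
    rw [Complex.mul_re]
    simp [hre]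
  rw [perronNumerator_div_sq h0 h1, completedLFunction_two_mul heven (by simp [hre])]
  have key : χ.LFunction (2 * w) * riemannZeta (2 * w) ^ 2 =
      ∑' n : ℕ, scrD χ n * (n : ℂ) ^ (-(2 * w)) := by
    rw [← LSeries_scrD χ hs, LSeries]
    exact tsum_congr fun n => LSeries_term_scrD χ _ n
  have : (π : ℂ) ^ w * (χ.LFunction (2 * w) * (π : ℂ) ^ (-w) * Complex.Gamma w) *
      riemannZeta (2 * w) ^ 2 * (Complex.Gamma (w + ρ + 1))⁻¹ * (x : ℂ) ^ (2 * w) =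
      (rieszKernel ρ w * (x : ℂ) ^ (2 * w)) *
        (χ.LFunction (2 * w) * riemannZeta (2 * w) ^ 2) := by
    rw [Complex.cpow_neg, rieszKernel]
    field_simp
  rw [this, key, ← tsum_mul_left]
  refine tsum_congr fun n => ?_
  rcases Nat.eq_zero_or_pos n with rfl | hn
  · simp [scrD_zero]
  have hn' : (0 : ℝ) < n := by exact_mod_cast hn
  have e : ((((n : ℝ) / x) ^ 2 : ℝ) : ℂ) ^ (-w) = (n : ℂ) ^ (-(2 * w)) * (x : ℂ) ^ (2 * w) := by
    have hd : (0 : ℝ) < (n : ℝ) / x := by positivity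
    have hxc : (x : ℂ) ≠ 0 := by exact_mod_cast hx.ne'
    have hnc : (n : ℂ) ≠ 0 := by exact_mod_cast hn'.ne'
    rw [Complex.cpow_def_of_ne_zero (by exact_mod_cast (pow_pos hd 2).ne'),
      Complex.cpow_def_of_ne_zero hnc, Complex.cpow_def_of_ne_zero hxc, ← Complex.exp_add,
      ← Complex.ofReal_log (pow_pos hd 2).le, Real.log_pow, Real.log_div hn'.ne' hx.ne',
      ← Complex.ofReal_log hx.le, ← Complex.natCast_log]
    push_cast
    congr 1
    ring
  rw [e]
  ring

lemma norm_scrD_mul_rieszKernel_mul_cpow {N : ℕ} {χ : DirichletCharacter ℂ N} (hx : 0 < x)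
    (n : ℕ) (τ : ℝ) :
    ‖scrD χ n * (rieszKernel ρ (1 + τ * Complex.I) *
        ((((n : ℝ) / x) ^ 2 : ℝ) : ℂ) ^ (-(1 + τ * Complex.I)))‖ =
      ‖scrD χ n‖ * (n : ℝ) ^ (-2 : ℝ) * (x ^ 2 * ‖rieszKernel ρ (1 + τ * Complex.I)‖) := by
  rcases Nat.eq_zero_or_pos n with rfl | hn
  · simp [scrD_zero]
  have hn' : (0 : ℝ) < n := by exact_mod_cast hn
  rw [norm_mul, norm_mul, Complex.norm_cpow_eq_rpow_re_of_pos (by positivity)]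
  have : (-(1 + τ * Complex.I)).re = -1 := by simp
  rw [this, Real.rpow_neg_one, show (-2 : ℝ) = -((2 : ℕ) : ℝ) by norm_num, Real.rpow_neg hn'.le,
    Real.rpow_natCast]
  field_simp

lemma integrable_perronNumerator_line_one (hρ : 1 < ρ) (hχ : χ ≠ 1) (heven : χ.Even)
    (hx : 0 < x) :
    MeasureTheory.Integrable fun τ : ℝ => perronNumerator χ ρ x (1 + τ * Complex.I) /
      (1 + τ * Complex.I - ((1 / 2 : ℝ) : ℂ)) ^ 2 := by
  have hs := summable_norm_scrD_mul_rpow χ (σ := 2) (by norm_num)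
  have hcont : Continuous fun τ : ℝ => perronNumerator χ ρ x (1 + τ * Complex.I) /
      (1 + τ * Complex.I - ((1 / 2 : ℝ) : ℂ)) ^ 2 := by
    refine Continuous.div ((differentiable_perronNumerator hχ ρ hx).continuous.comp
      (by fun_prop)) (by fun_prop) fun τ => pow_ne_zero 2 ?_
    have := add_mul_I_ne_zero (d := 1 / 2) (by norm_num) τ
    intro h
    apply this
    rw [← h]
    push_cast
    ring
  refine MeasureTheory.Integrable.mono'
    (((integrable_rieszKernel hρ).norm.const_mul (x ^ 2)).const_mul
      (∑' n : ℕ, ‖scrD χ n‖ * (n : ℝ) ^ (-2 : ℝ)))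
    hcont.aestronglyMeasurable (Filter.Eventually.of_forall fun τ => ?_)
  rw [perronNumerator_div_sq_line_one heven hx, ← tsum_mul_right]
  simp_rw [← norm_scrD_mul_rieszKernel_mul_cpow hx]
  refine norm_tsum_le_tsum_norm ?_
  simp_rw [norm_scrD_mul_rieszKernel_mul_cpow hx]
  exact hs.mul_right _

lemma integral_perronNumerator_line_one (hρ : 1 < ρ) (heven : χ.Even) (hx : 0 < x) :
    ∫ τ : ℝ, perronNumerator χ ρ x (1 + τ * Complex.I) /
      (1 + τ * Complex.I - ((1 / 2 : ℝ) : ℂ)) ^ 2 =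
    2 * π * ∑ n ∈ Finset.Icc 1 ⌊x⌋₊,
      scrD χ n * (((1 - ((n : ℝ) / x) ^ 2) ^ ρ / Real.Gamma (ρ + 1) : ℝ) : ℂ) := by
  have hs := summable_norm_scrD_mul_rpow χ (σ := 2) (by norm_num)
  simp_rw [perronNumerator_div_sq_line_one heven hx]
  have hmeas : ∀ n : ℕ, MeasureTheory.Integrable fun τ : ℝ =>
      scrD χ n * (rieszKernel ρ (1 + τ * Complex.I) *
        ((((n : ℝ) / x) ^ 2 : ℝ) : ℂ) ^ (-(1 + τ * Complex.I))) := by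
    intro n
    rcases Nat.eq_zero_or_pos n with rfl | hn
    · simp [scrD_zero]
    have hn' : (0 : ℝ) < n := by exact_mod_cast hn
    have hv : (0 : ℝ) < ((n : ℝ) / x) ^ 2 := by positivity
    have hc : Continuous fun τ : ℝ => scrD χ n * (rieszKernel ρ (1 + τ * Complex.I) *
        ((((n : ℝ) / x) ^ 2 : ℝ) : ℂ) ^ (-(1 + τ * Complex.I))) := by
      refine continuous_const.mul ((continuous_rieszKernel ρ).mul ?_)
      exact Continuous.const_cpow (by fun_prop) (Or.inl (by exact_mod_cast hv.ne'))
    refine MeasureTheory.Integrable.mono'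
      (((integrable_rieszKernel hρ).norm.const_mul (x ^ 2)).const_mul
        (‖scrD χ n‖ * (n : ℝ) ^ (-2 : ℝ))) hc.aestronglyMeasurable
      (Filter.Eventually.of_forall fun τ => (norm_scrD_mul_rieszKernel_mul_cpow hx n τ).le)
  rw [← (MeasureTheory.hasSum_integral_of_summable_integral_norm hmeas ?_).tsum_eq]
  · rw [tsum_eq_sum (s := Finset.Icc 1 ⌊x⌋₊), Finset.mul_sum]
    · refine Finset.sum_congr rfl fun n hn => ?_
      rw [Finset.mem_Icc] at hn
      have hn' : (0 : ℝ) < n := by exact_mod_cast hn.1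
      have hnx : (n : ℝ) ≤ x := (Nat.le_floor_iff hx.le).mp hn.2
      rw [MeasureTheory.integral_const_mul, integral_rieszKernel_mul_cpow hρ (by positivity),
        max_eq_left]
      · ring
      · have : (n : ℝ) / x ≤ 1 := (div_le_one hx).mpr hnx
        have h0 : 0 ≤ (n : ℝ) / x := by positivity
        nlinarith
    · intro n hn
      rcases Nat.eq_zero_or_pos n with rfl | hn0
      · simp [scrD_zero]
      have hn' : (0 : ℝ) < n := by exact_mod_cast hn0
      have hnx : x < n := by
        by_contra! h
        exact hn (Finset.mem_Icc.mpr ⟨hn0, (Nat.le_floor_iff hx.le).mpr h⟩)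
      rw [MeasureTheory.integral_const_mul, integral_rieszKernel_mul_cpow hρ (by positivity),
        max_eq_right]
      · simp [Real.zero_rpow (by linarith : ρ ≠ 0)]
      · have : 1 < (n : ℝ) / x := (one_lt_div hx).mpr hnx
        nlinarith
  · simp_rw [norm_scrD_mul_rieszKernel_mul_cpow hx, MeasureTheory.integral_const_mul]
    exact hs.mul_right _

/-- The Gamma quotient that appears on the dual side of the functional equation. -/
noncomputable def dualKernel (ρ : ℝ) (w : ℂ) : ℂ :=
  Complex.Gamma (1 / 2 - w) ^ 3 * (Complex.Gamma w)⁻¹ ^ 2 * (Complex.Gamma (w + ρ + 1))⁻¹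

lemma dualKernel_conj (ρ : ℝ) (w : ℂ) :
    dualKernel ρ ((starRingEnd ℂ) w) = (starRingEnd ℂ) (dualKernel ρ w) := by
  simp only [dualKernel, map_mul, map_pow, map_inv₀, ← Complex.Gamma_conj, map_sub, map_add,
    map_div₀, map_one, Complex.conj_ofReal, map_ofNat]

lemma continuous_dualKernel_vertical (ρ : ℝ) {σ : ℝ} (hσ : σ < 1 / 2) :
    Continuous fun τ : ℝ => dualKernel ρ (σ + τ * Complex.I) := by
  unfold dualKernel
  have h1 : Continuous fun τ : ℝ => Complex.Gamma (1 / 2 - (σ + τ * Complex.I)) := by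
    rw [continuous_iff_continuousAt]
    intro τ
    refine ContinuousAt.comp (g := Complex.Gamma)
      (Complex.differentiableAt_Gamma _ fun m h => ?_).continuousAt (by fun_prop)
    have := congrArg Complex.re h
    simp at this
    have hm : (0 : ℝ) ≤ m := Nat.cast_nonneg m
    linarith
  have hG : Continuous fun w : ℂ => (Complex.Gamma w)⁻¹ :=
    Complex.differentiable_one_div_Gamma.continuous
  have h2 : Continuous fun τ : ℝ => (Complex.Gamma (σ + τ * Complex.I))⁻¹ :=
    hG.comp (by fun_prop)
  have h3 : Continuous fun τ : ℝ => (Complex.Gamma (σ + τ * Complex.I + ρ + 1))⁻¹ :=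
    hG.comp (by fun_prop)
  exact ((h1.pow 3).mul (h2.pow 2)).mul h3

lemma exists_norm_dualKernel_sub_le (ρ : ℝ) : ∃ A : ℂ, ∃ C t₀ : ℝ, 1 ≤ t₀ ∧ ∀ τ : ℝ, t₀ ≤ τ →
    ‖dualKernel ρ (((1 / 8 - ρ / 6 : ℝ) : ℂ) + τ * Complex.I) -
      A * (((τ ^ (-(1 / 4) : ℝ) : ℝ) : ℂ) *
        Complex.exp (((-6 * (τ * Real.log τ - τ) : ℝ) : ℂ) * Complex.I))‖ ≤
      C * τ ^ (-(5 / 4) : ℝ) := by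
  set σ : ℝ := 1 / 8 - ρ / 6 with hσ
  obtain ⟨R₁, hR₁, e₁⟩ := exists_Gamma_vertical_eq (1 / 2 - σ)
  obtain ⟨R₂, hR₂, e₂⟩ := exists_Gamma_vertical_eq σ
  obtain ⟨R₃, hR₃, e₃⟩ := exists_Gamma_vertical_eq (σ + ρ + 1)
  set R : ℝ → ℂ := fun τ => 3 * (starRingEnd ℂ) (R₁ τ) - 2 * R₂ τ - R₃ τ with hR
  have hRO : R =O[atTop] fun τ : ℝ => τ⁻¹ := by
    have h1 : (fun τ => (starRingEnd ℂ) (R₁ τ)) =O[atTop] fun τ : ℝ => τ⁻¹ :=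
      (isBigO_of_le _ fun τ => by simp).trans hR₁
    exact ((h1.const_mul_left 3).sub (hR₂.const_mul_left 2)).sub hR₃
  obtain ⟨C, hC⟩ := hRO.bound
  have hsmall : ∀ᶠ τ : ℝ in atTop, C * ‖τ⁻¹‖ ≤ 1 := by
    have : Tendsto (fun τ : ℝ => C * ‖τ⁻¹‖) atTop (nhds (C * ‖(0 : ℝ)‖)) :=
      (tendsto_inv_atTop_zero.norm).const_mul C
    rw [norm_zero, mul_zero] at this
    exact this.eventually (eventually_le_nhds one_pos)
  refine ⟨Complex.exp (((π / 2 * (1 / 2 - ρ) : ℝ) : ℂ) * Complex.I), 2 * C, ?_⟩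
  have hev := hC.and (hsmall.and (e₁.and (e₂.and e₃)))
  obtain ⟨T, hT⟩ := eventually_atTop.mp hev
  refine ⟨max T 1, le_max_right _ _, fun τ hτ => ?_⟩
  obtain ⟨hb, hs, g₁, g₂, g₃⟩ := hT τ ((le_max_left _ _).trans hτ)
  have hτ0 : 0 < τ := lt_of_lt_of_le one_pos ((le_max_right _ _).trans hτ)
  have g₁' : Complex.Gamma (1 / 2 - (σ + τ * Complex.I)) =
      (starRingEnd ℂ) (Complex.Gamma (((1 / 2 - σ : ℝ) : ℂ) + τ * Complex.I)) := by
    rw [← Complex.Gamma_conj]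
    congr 1
    simp only [map_add, map_mul, Complex.conj_ofReal, Complex.conj_I]
    push_cast
    ring
  have g₃' : Complex.Gamma (σ + τ * Complex.I + ρ + 1) =
      Complex.Gamma (((σ + ρ + 1 : ℝ) : ℂ) + τ * Complex.I) := by
    congr 1
    push_cast
    ring
  have main : dualKernel ρ (σ + τ * Complex.I) =
      Complex.exp (((π / 2 * (1 / 2 - ρ) : ℝ) : ℂ) * Complex.I) * (((τ ^ (-(1 / 4) : ℝ) : ℝ) : ℂ) *
        Complex.exp (((-6 * (τ * Real.log τ - τ) : ℝ) : ℂ) * Complex.I)) *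
        Complex.exp (R τ) := by
    rw [dualKernel, g₁', g₁, g₂, g₃', g₃, ← Complex.exp_conj, ← Complex.exp_neg,
      ← Complex.exp_neg, ← Complex.exp_nat_mul, ← Complex.exp_nat_mul,
      Real.rpow_def_of_pos hτ0, Complex.ofReal_exp]
    simp only [← Complex.exp_add]
    congr 1
    simp only [hR, map_add, map_sub, map_mul, Complex.conj_ofReal, Complex.conj_I, map_div₀,
      map_one, map_ofNat]
    rw [hσ]
    push_cast
    ring
  rw [main, ← mul_sub_one, norm_mul, norm_mul, norm_mul, Complex.norm_exp_ofReal_mul_I,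
    Complex.norm_exp_ofReal_mul_I, Complex.norm_real, Real.norm_of_nonneg (by positivity),
    one_mul, mul_one]
  have h1 : ‖Complex.exp (R τ) - 1‖ ≤ 2 * (C * τ⁻¹) := by
    rw [Real.norm_of_nonneg (inv_pos.mpr hτ0).le] at hb hs
    exact (Complex.norm_exp_sub_one_le (hb.trans hs)).trans (by linarith)
  calc τ ^ (-(1 / 4) : ℝ) * ‖Complex.exp (R τ) - 1‖
      ≤ τ ^ (-(1 / 4) : ℝ) * (2 * (C * τ⁻¹)) := by gcongr
    _ = 2 * C * (τ ^ (-(1 / 4) : ℝ) * τ ^ (-1 : ℝ)) := by rw [Real.rpow_neg_one]; ring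
    _ = 2 * C * τ ^ (-(5 / 4) : ℝ) := by rw [← Real.rpow_add hτ0]; norm_num

lemma inv_eq_self_of_im_eq_zero {N : ℕ} {χ : DirichletCharacter ℂ N}
    (hreal : ∀ a : ZMod N, (χ a).im = 0) : χ⁻¹ = χ := by
  rw [← MulChar.star_eq_inv]
  ext a
  rw [MulChar.star_apply]
  exact Complex.conj_eq_iff_im.mpr (hreal a)

lemma exists_norm_integral_dualKernel_mul_cpow_le (hρ : 1 < ρ) : ∃ M Y₀ : ℝ, 1 ≤ Y₀ ∧ 0 ≤ M ∧
    ∀ Y, Y₀ ≤ Y → ∀ ε : ℝ, 0 < ε → ε ≤ 1 →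
      ‖∫ τ : ℝ, dualKernel ρ (((1 / 8 - ρ / 6 : ℝ) : ℂ) + τ * Complex.I) *
        (Y : ℂ) ^ (2 * (((1 / 8 - ρ / 6 : ℝ) : ℂ) + τ * Complex.I)) *
        Complex.exp (ε * (((1 / 8 - ρ / 6 : ℝ) : ℂ) + τ * Complex.I) ^ 2)‖ ≤
      M * Y ^ ((1 - ρ) / 3) := by
  obtain ⟨A, C, t₀, ht₀, hA⟩ := exists_norm_dualKernel_sub_le ρ
  set σ : ℝ := 1 / 8 - ρ / 6 with hσ
  have hσ0 : σ < 0 := by rw [hσ]; linarith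
  have hk := continuous_dualKernel_vertical ρ (σ := σ) (by linarith)
  obtain ⟨M, X₀, hX₀, hM, h⟩ := exists_norm_integral_kernel_le hk (fun t => by
    rw [← dualKernel_conj]
    congr 1
    simp only [map_add, map_mul, Complex.conj_ofReal, Complex.conj_I]
    push_cast
    ring) ht₀ hA
  refine ⟨Real.exp (σ ^ 2) * M, X₀ ^ 3 * Real.exp (-σ), ?_, by positivity, fun Y hY ε hε hε1 => ?_⟩
  · exact one_le_mul_of_one_le_of_one_le (one_le_pow₀ hX₀) (Real.one_le_exp (by linarith))
  have hX0pos : 0 < X₀ := by linarith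
  have hYpos : 0 < Y := lt_of_lt_of_le (by positivity) hY
  set X : ℝ := Real.exp ((Real.log Y + ε * σ) / 3) with hX
  have hlogY : 3 * Real.log X₀ - σ ≤ Real.log Y := by
    have := Real.log_le_log (by positivity) hY
    rw [Real.log_mul (by positivity) (by positivity), Real.log_exp, Real.log_pow] at this
    push_cast at this
    linarith
  have hXX : X₀ ≤ X := by
    rw [← Real.exp_log hX0pos, hX]
    refine Real.exp_le_exp.mpr ?_
    nlinarith
  have hlogX : Real.log X = (Real.log Y + ε * σ) / 3 := by rw [hX, Real.log_exp]
  have hint := h X hXX ε hε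
  have hfun : ∀ τ : ℝ, dualKernel ρ (σ + τ * Complex.I) * (Y : ℂ) ^ (2 * (σ + τ * Complex.I)) *
        Complex.exp (ε * (σ + τ * Complex.I) ^ 2) =
      ((Real.exp (2 * σ * Real.log Y + ε * σ ^ 2) : ℝ) : ℂ) *
      (dualKernel ρ (σ + τ * Complex.I) *
        Complex.exp (((6 * τ * Real.log X : ℝ) : ℂ) * Complex.I) *
        (Real.exp (-ε * τ ^ 2) : ℂ)) := by
    intro τ
    rw [Complex.cpow_def_of_ne_zero (by exact_mod_cast hYpos.ne'), ← Complex.ofReal_log hYpos.le,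
      hlogX, Complex.ofReal_exp, Complex.ofReal_exp]
    have : Complex.exp ((Real.log Y : ℂ) * (2 * (σ + τ * Complex.I))) *
        Complex.exp (ε * (σ + τ * Complex.I) ^ 2) =
        Complex.exp (((2 * σ * Real.log Y + ε * σ ^ 2 : ℝ) : ℂ)) *
        (Complex.exp (((6 * τ * ((Real.log Y + ε * σ) / 3) : ℝ) : ℂ) * Complex.I) *
        Complex.exp (((-ε * τ ^ 2 : ℝ) : ℂ))) := by
      rw [← Complex.exp_add, ← Complex.exp_add, ← Complex.exp_add]
      congr 1
      push_cast
      ring_nf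
      simp only [Complex.I_sq]
      ring
    linear_combination (dualKernel ρ (σ + τ * Complex.I)) * this
  simp_rw [hfun]
  rw [MeasureTheory.integral_const_mul, norm_mul, Complex.norm_real,
    Real.norm_of_nonneg (Real.exp_pos _).le]
  have hX4 : X ^ (1 / 4 : ℝ) ≤ Real.exp (Real.log Y / 12) := by
    rw [hX, ← Real.exp_mul]
    refine Real.exp_le_exp.mpr ?_
    nlinarith
  calc Real.exp (2 * σ * Real.log Y + ε * σ ^ 2) * _
      ≤ Real.exp (2 * σ * Real.log Y + σ ^ 2) * (M * Real.exp (Real.log Y / 12)) := by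
        refine mul_le_mul (Real.exp_le_exp.mpr ?_) (hint.trans (by gcongr)) (norm_nonneg _)
          (Real.exp_pos _).le
        nlinarith [sq_nonneg σ]
    _ = Real.exp (σ ^ 2) * M * Y ^ ((1 - ρ) / 3) := by
        rw [Real.rpow_def_of_pos hYpos, Real.exp_add]
        have : Real.exp (Real.log Y * ((1 - ρ) / 3)) =
            Real.exp (2 * σ * Real.log Y) * Real.exp (Real.log Y / 12) := by
          rw [← Real.exp_add, hσ]
          congr 1
          ring
        rw [this]
        ring

/-- The scaling parameter `π³ n x / N` of the dual sum. -/
noncomputable def dualScale (N : ℕ) (x : ℝ) (n : ℕ) : ℝ := π ^ 3 * n * x / N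

lemma dualScale_pos {n : ℕ} (hn : 0 < n) (hx : 0 < x) : 0 < dualScale N x n := by
  have hN : (0 : ℝ) < N := by exact_mod_cast NeZero.pos N
  have : (0 : ℝ) < n := by exact_mod_cast hn
  unfold dualScale
  positivity

lemma exists_perronNumerator_div_sq_eq_dual (heven : χ.Even) (hprim : χ.IsPrimitive)
    (hinv : χ⁻¹ = χ) (ρ : ℝ) : ∃ c : ℂ, ∀ x : ℝ, 0 < x → ∀ w : ℂ, w.re < 0 →
    perronNumerator χ ρ x w / (w - ((1 / 2 : ℝ) : ℂ)) ^ 2 =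
      c * ∑' n : ℕ, scrD χ n / n * (dualKernel ρ w * (dualScale N x n : ℂ) ^ (2 * w)) := by
  have hπ : (π : ℂ) ≠ 0 := by exact_mod_cast Real.pi_ne_zero
  have hNp : (0 : ℝ) < N := by exact_mod_cast NeZero.pos N
  have hNc : (N : ℂ) ≠ 0 := by exact_mod_cast hNp.ne'
  refine ⟨(N : ℂ) ^ (1 / 2 : ℂ) * χ.rootNumber * (π : ℂ) ^ (-(3 / 2) : ℂ), fun x hx w hw => ?_⟩
  have hxc : (x : ℂ) ≠ 0 := by exact_mod_cast hx.ne'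
  have h0 : w ≠ 0 := fun h => by simp [h] at hw
  have h1 : w ≠ 1 / 2 := fun h => by rw [h] at hw; norm_num at hw
  set u : ℂ := 1 / 2 - w with hu
  have hure : 0 < u.re := by simp [hu]; linarith
  have hu0 : 2 * u ≠ 0 := by
    intro h
    have : u = 0 := by simpa using h
    simp [this] at hure
  have h2w : 2 * w = 1 - 2 * u := by rw [hu]; ring
  have hL : χ.completedLFunction (2 * w) =
      (N : ℂ) ^ (2 * u - 1 / 2) * χ.rootNumber *
        (χ.LFunction (2 * u) * (π : ℂ) ^ (-u) * Complex.Gamma u) := by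
    rw [h2w, hprim.completedLFunction_one_sub, hinv, completedLFunction_two_mul heven hure]
  have hζ : riemannZeta (2 * w) = riemannZeta (2 * u) * (π : ℂ) ^ (-u) * Complex.Gamma u *
      ((π : ℂ) ^ w * (Complex.Gamma w)⁻¹) := by
    have hd : Complex.Gammaℝ (2 * u) = (π : ℂ) ^ (-u) * Complex.Gamma u := by
      rw [Complex.Gammaℝ_def]
      congr 2 <;> ring
    have hd' : Complex.Gammaℝ (2 * w) = (π : ℂ) ^ (-w) * Complex.Gamma w := by
      rw [Complex.Gammaℝ_def]
      congr 2 <;> ring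
    have hz : completedRiemannZeta (2 * u) = riemannZeta (2 * u) * ((π : ℂ) ^ (-u) *
        Complex.Gamma u) := by
      rw [riemannZeta_def_of_ne_zero hu0, ← hd, div_mul_cancel₀]
      exact Complex.Gammaℝ_ne_zero_of_re_pos (by simpa using hure)
    rw [riemannZeta_def_of_ne_zero (by simpa using h0), hd', h2w, completedRiemannZeta_one_sub,
      hz, Complex.cpow_neg _ w]
    simp only [div_eq_mul_inv, mul_inv, inv_inv]
    ring
  have hs : 1 < (2 * u).re := by
    rw [Complex.mul_re]
    simp [hu]
    linarith
  have key : χ.LFunction (2 * u) * riemannZeta (2 * u) ^ 2 =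
      ∑' n : ℕ, scrD χ n * (n : ℂ) ^ (-(2 * u)) := by
    rw [← LSeries_scrD χ hs, LSeries]
    exact tsum_congr fun n => LSeries_term_scrD χ _ n
  rw [perronNumerator_div_sq h0 h1, hL, hζ]
  have e : (π : ℂ) ^ w * ((N : ℂ) ^ (2 * u - 1 / 2) * χ.rootNumber *
        (χ.LFunction (2 * u) * (π : ℂ) ^ (-u) * Complex.Gamma u)) *
      (riemannZeta (2 * u) * (π : ℂ) ^ (-u) * Complex.Gamma u *
      ((π : ℂ) ^ w * (Complex.Gamma w)⁻¹)) ^ 2 * (Complex.Gamma (w + ρ + 1))⁻¹ *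
        (x : ℂ) ^ (2 * w) =
      ((π : ℂ) ^ w * (π : ℂ) ^ w * (π : ℂ) ^ w * (π : ℂ) ^ (-u) * (π : ℂ) ^ (-u) *
        (π : ℂ) ^ (-u) * (N : ℂ) ^ (2 * u - 1 / 2) * χ.rootNumber * dualKernel ρ w *
        (x : ℂ) ^ (2 * w)) *
      (χ.LFunction (2 * u) * riemannZeta (2 * u) ^ 2) := by
    rw [dualKernel, ← hu]
    ring
  rw [e, key, ← tsum_mul_left, ← tsum_mul_left]
  refine tsum_congr fun n => ?_
  rcases Nat.eq_zero_or_pos n with rfl | hn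
  · simp [scrD_zero]
  have hn' : (0 : ℝ) < n := by exact_mod_cast hn
  have hnc : (n : ℂ) ≠ 0 := by exact_mod_cast hn'.ne'
  have hY := dualScale_pos (N := N) hn hx
  have hlog : Real.log (dualScale N x n) = 3 * Real.log π + Real.log n + Real.log x -
      Real.log N := by
    rw [dualScale, Real.log_div (by positivity) hNp.ne', Real.log_mul (by positivity) hx.ne',
      Real.log_mul (by positivity) hn'.ne', Real.log_pow]
    push_cast
    ring
  have e2 : (π : ℂ) ^ w * (π : ℂ) ^ w * (π : ℂ) ^ w * (π : ℂ) ^ (-u) * (π : ℂ) ^ (-u) *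
        (π : ℂ) ^ (-u) * (N : ℂ) ^ (2 * u - 1 / 2) * (x : ℂ) ^ (2 * w) * (n : ℂ) ^ (-(2 * u)) =
      (N : ℂ) ^ (1 / 2 : ℂ) * (π : ℂ) ^ (-(3 / 2) : ℂ) * (n : ℂ) ^ (-1 : ℂ) *
        (dualScale N x n : ℂ) ^ (2 * w) := by
    rw [Complex.cpow_def_of_ne_zero (x := (dualScale N x n : ℂ)) (by exact_mod_cast hY.ne'),
      ← Complex.ofReal_log hY.le, hlog]
    simp only [Complex.cpow_def_of_ne_zero hπ, Complex.cpow_def_of_ne_zero hxc,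
      Complex.cpow_def_of_ne_zero hNc, Complex.cpow_def_of_ne_zero hnc,
      ← Complex.ofReal_log hx.le, ← Complex.ofReal_log Real.pi_pos.le, ← Complex.natCast_log,
      ← Complex.exp_add]
    rw [hu]
    congr 1
    push_cast
    ring
  rw [Complex.cpow_neg_one] at e2
  rw [div_eq_mul_inv (scrD χ n) (n : ℂ)]
  linear_combination χ.rootNumber * dualKernel ρ w * scrD χ n * e2

lemma integrable_dualKernel_mul_cpow_mul_gaussian (hρ : 1 < ρ) {Y ε : ℝ} (hY : 0 < Y)
    (hε : 0 < ε) :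
    MeasureTheory.Integrable fun τ : ℝ =>
      dualKernel ρ (((1 / 8 - ρ / 6 : ℝ) : ℂ) + τ * Complex.I) *
        (Y : ℂ) ^ (2 * (((1 / 8 - ρ / 6 : ℝ) : ℂ) + τ * Complex.I)) *
        Complex.exp (ε * (((1 / 8 - ρ / 6 : ℝ) : ℂ) + τ * Complex.I) ^ 2) := by
  obtain ⟨A, C, t₀, ht₀, hA⟩ := exists_norm_dualKernel_sub_le ρ
  set σ : ℝ := 1 / 8 - ρ / 6 with hσ
  have hk := continuous_dualKernel_vertical ρ (σ := σ) (by rw [hσ]; linarith)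
  obtain ⟨B, hB⟩ := exists_norm_le_of_asymptotic hk (fun t => by
    rw [← dualKernel_conj]
    congr 1
    simp only [map_add, map_mul, Complex.conj_ofReal, Complex.conj_I]
    push_cast
    ring) ht₀ hA
  have hYc : (Y : ℂ) ≠ 0 := by exact_mod_cast hY.ne'
  have hc : Continuous fun τ : ℝ => dualKernel ρ (σ + τ * Complex.I) *
      (Y : ℂ) ^ (2 * (σ + τ * Complex.I)) * Complex.exp (ε * (σ + τ * Complex.I) ^ 2) :=
    (hk.mul (Continuous.const_cpow (by fun_prop) (Or.inl hYc))).mul (by fun_prop)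
  have hg := (integrable_mul_gaussian (g := fun _ => (1 : ℂ)) continuous_const
    (B := 1) (by simp) hε).norm.const_mul (B * Y ^ (2 * σ) * Real.exp (ε * σ ^ 2))
  refine hg.mono' hc.aestronglyMeasurable (Filter.Eventually.of_forall fun τ => ?_)
  have hre : (2 * ((σ : ℂ) + τ * Complex.I)).re = 2 * σ := by
    rw [Complex.mul_re]
    simp
  rw [norm_mul, norm_mul, norm_cexp_mul_sq_vertical, Complex.norm_cpow_eq_rpow_re_of_pos hY, hre,
    one_mul, Complex.norm_real, Real.norm_of_nonneg (Real.exp_pos _).le, sub_eq_add_neg,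
    Real.exp_add, neg_mul]
  have := hB τ
  have h1 : 0 ≤ Y ^ (2 * σ) * (Real.exp (ε * σ ^ 2) * Real.exp (-(ε * τ ^ 2))) := by positivity
  calc _ = ‖dualKernel ρ (σ + τ * Complex.I)‖ *
        (Y ^ (2 * σ) * (Real.exp (ε * σ ^ 2) * Real.exp (-(ε * τ ^ 2)))) := by ring
    _ ≤ B * (Y ^ (2 * σ) * (Real.exp (ε * σ ^ 2) * Real.exp (-(ε * τ ^ 2)))) := by gcongr
    _ = _ := by ring

/-- Uniform bound for the smoothed integral of the Perron integrand over the dual line. -/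
theorem exists_norm_integral_perronNumerator_dual_le (heven : χ.Even)
    (hprim : χ.IsPrimitive) (hinv : χ⁻¹ = χ) (hρ : 1 < ρ) : ∃ B X₁ : ℝ, 1 ≤ X₁ ∧
    ∀ x, X₁ ≤ x → ∀ ε : ℝ, 0 < ε → ε ≤ 1 →
      ‖∫ τ : ℝ, perronNumerator χ ρ x (((1 / 8 - ρ / 6 : ℝ) : ℂ) + τ * Complex.I) *
        Complex.exp (ε * (((1 / 8 - ρ / 6 : ℝ) : ℂ) + τ * Complex.I) ^ 2) /
        (((1 / 8 - ρ / 6 : ℝ) : ℂ) + τ * Complex.I - ((1 / 2 : ℝ) : ℂ)) ^ 2‖ ≤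
      B * x ^ ((1 - ρ) / 3) := by
  obtain ⟨c, hc⟩ := exists_perronNumerator_div_sq_eq_dual heven hprim hinv ρ
  obtain ⟨M, Y₀, hY₀, hM, hMY⟩ := exists_norm_integral_dualKernel_mul_cpow_le hρ
  have hint := fun {Y ε : ℝ} => integrable_dualKernel_mul_cpow_mul_gaussian hρ (Y := Y) (ε := ε)
  set σ : ℝ := 1 / 8 - ρ / 6 with hσ
  have hσ0 : σ < 0 := by rw [hσ]; linarith
  have hNp : (1 : ℝ) ≤ N := by exact_mod_cast NeZero.one_le
  have hs₁ := summable_norm_scrD_mul_rpow χ (σ := 1 - 2 * σ) (by linarith)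
  have hs₂ := summable_norm_scrD_mul_rpow χ (σ := 1 + (ρ - 1) / 3) (by linarith)
  set S : ℝ := ∑' n : ℕ, ‖scrD χ n‖ * (n : ℝ) ^ (-(1 + (ρ - 1) / 3)) with hS
  refine ⟨‖c‖ * (S * (M * (π ^ 3 / N) ^ ((1 - ρ) / 3))), N * Y₀, by nlinarith,
    fun x hx ε hε hε1 => ?_⟩
  have hx0 : 0 < x := by nlinarith
  set G : ℝ → ℝ → ℂ := fun Y τ => dualKernel ρ (σ + τ * Complex.I) *
    (Y : ℂ) ^ (2 * (σ + τ * Complex.I)) * Complex.exp (ε * (σ + τ * Complex.I) ^ 2) with hG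
  have hGnorm : ∀ Y : ℝ, 0 < Y → ∀ τ, ‖G Y τ‖ = Y ^ (2 * σ) * ‖G 1 τ‖ := by
    intro Y hY τ
    have hre : (2 * ((σ : ℂ) + τ * Complex.I)).re = 2 * σ := by
      rw [Complex.mul_re]
      simp
    simp only [hG, norm_mul, Complex.norm_cpow_eq_rpow_re_of_pos hY, hre, Complex.ofReal_one,
      Complex.one_cpow, norm_one]
    ring
  have hfun : ∀ τ : ℝ, perronNumerator χ ρ x (σ + τ * Complex.I) *
      Complex.exp (ε * (σ + τ * Complex.I) ^ 2) /
      ((σ : ℂ) + τ * Complex.I - ((1 / 2 : ℝ) : ℂ)) ^ 2 =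
      c * ∑' n : ℕ, scrD χ n / n * G (dualScale N x n) τ := by
    intro τ
    have := hc x hx0 (σ + τ * Complex.I) (by simpa using hσ0)
    rw [mul_div_right_comm, this, mul_assoc, ← tsum_mul_right]
    congr 1
    refine tsum_congr fun n => ?_
    rw [hG]
    ring
  have hGint : ∀ n : ℕ, MeasureTheory.Integrable fun τ : ℝ =>
      scrD χ n / n * G (dualScale N x n) τ := by
    intro n
    rcases Nat.eq_zero_or_pos n with rfl | hn
    · simp [scrD_zero]
    exact (hint (dualScale_pos hn hx0) hε).const_mul _
  have hsum : Summable fun n : ℕ => ∫ τ : ℝ, ‖scrD χ n / n * G (dualScale N x n) τ‖ := by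
    refine (hs₁.mul_right ((π ^ 3 * x / N) ^ (2 * σ) * ∫ τ : ℝ, ‖G 1 τ‖)).congr fun n => ?_
    rcases Nat.eq_zero_or_pos n with rfl | hn
    · simp [scrD_zero]
    have hn' : (0 : ℝ) < n := by exact_mod_cast hn
    simp_rw [norm_mul, hGnorm _ (dualScale_pos hn hx0)]
    rw [MeasureTheory.integral_const_mul, MeasureTheory.integral_const_mul, norm_div,
      Complex.norm_natCast]
    have e1 : dualScale N x n = n * (π ^ 3 * x / N) := by
      rw [dualScale]
      ring
    rw [e1, Real.mul_rpow hn'.le (by positivity), show -(1 - 2 * σ) = 2 * σ - 1 by ring,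
      Real.rpow_sub_one hn'.ne']
    ring
  simp_rw [hfun]
  rw [MeasureTheory.integral_const_mul,
    ← (MeasureTheory.hasSum_integral_of_summable_integral_norm hGint hsum).tsum_eq, norm_mul,
    mul_assoc]
  refine mul_le_mul_of_nonneg_left ?_ (norm_nonneg c)
  have hbound : ∀ n : ℕ, ‖∫ τ : ℝ, scrD χ n / n * G (dualScale N x n) τ‖ ≤
      ‖scrD χ n‖ * (n : ℝ) ^ (-(1 + (ρ - 1) / 3)) *
        (M * (π ^ 3 / N) ^ ((1 - ρ) / 3) * x ^ ((1 - ρ) / 3)) := by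
    intro n
    rcases Nat.eq_zero_or_pos n with rfl | hn
    · simp [scrD_zero]
    have hn' : (0 : ℝ) < n := by exact_mod_cast hn
    have hn1 : (1 : ℝ) ≤ n := by exact_mod_cast hn
    have hYn : Y₀ ≤ dualScale N x n := by
      have hπ : (1 : ℝ) ≤ π ^ 3 := one_le_pow₀ (by linarith [Real.two_le_pi])
      rw [dualScale, le_div_iff₀ (by linarith)]
      have h2 : 1 ≤ π ^ 3 * n := one_le_mul_of_one_le_of_one_le hπ hn1
      nlinarith
    have e1 : dualScale N x n = n * (π ^ 3 / N * x) := by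
      rw [dualScale]
      ring
    rw [MeasureTheory.integral_const_mul, norm_mul, norm_div, Complex.norm_natCast]
    calc ‖scrD χ n‖ / n * ‖∫ τ : ℝ, G (dualScale N x n) τ‖
        ≤ ‖scrD χ n‖ / n * (M * dualScale N x n ^ ((1 - ρ) / 3)) := by
          gcongr
          exact hMY _ hYn ε hε hε1
      _ = _ := by
          rw [e1, Real.mul_rpow hn'.le (by positivity), Real.mul_rpow (by positivity) hx0.le,
            show -(1 + (ρ - 1) / 3) = (1 - ρ) / 3 - 1 by ring, Real.rpow_sub_one hn'.ne']
          ring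
  refine (tsum_of_norm_bounded (hs₂.mul_right _).hasSum hbound).trans_eq ?_
  rw [tsum_mul_right, ← hS]
  ring

lemma hasDerivAt_complexGamma_ofReal {s : ℝ} (hs : 0 < s) :
    HasDerivAt Complex.Gamma ((deriv Real.Gamma s : ℝ) : ℂ) (s : ℂ) := by
  have hne : ∀ m : ℕ, s ≠ -m := fun m h => by
    have : (0 : ℝ) ≤ m := Nat.cast_nonneg m
    linarith
  have hd : DifferentiableAt ℂ Complex.Gamma (s : ℂ) :=
    Complex.differentiableAt_Gamma _ fun m h => hne m (by exact_mod_cast h)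
  have h1 : HasDerivAt (fun y : ℝ => Complex.Gamma (y : ℂ)) (deriv Complex.Gamma s) s :=
    hd.hasDerivAt.comp_ofReal
  have h2 : HasDerivAt (fun y : ℝ => Complex.Gamma (y : ℂ)) ((deriv Real.Gamma s : ℝ) : ℂ) s := by
    simp_rw [Complex.Gamma_ofReal]
    exact (Real.differentiableAt_Gamma hne).hasDerivAt.ofReal_comp
  rw [← h1.unique h2]
  exact hd.hasDerivAt

lemma zetaEntire_one_half : zetaEntire (1 / 2) = 1 := by
  have hπ : (π : ℂ) ≠ 0 := by exact_mod_cast Real.pi_ne_zero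
  have hp : (π : ℂ) ^ (1 / 2 : ℂ) ≠ 0 := by simp [Complex.cpow_eq_zero_iff, hπ]
  rw [zetaEntire, Complex.Gamma_add_one _ (by norm_num), Complex.Gamma_one_half_eq]
  field_simp
  ring

lemma hasDerivAt_zetaEntire_one_half :
    HasDerivAt zetaEntire (2 * Real.eulerMascheroniConstant) (1 / 2) := by
  rw [hasDerivAt_iff_tendsto_slope]
  have ht : Tendsto (fun w : ℂ => 2 * w) (nhdsWithin (1 / 2) {1 / 2}ᶜ) (nhdsWithin 1 {1}ᶜ) := by
    refine tendsto_nhdsWithin_iff.mpr ⟨?_, ?_⟩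
    · have : Tendsto (fun w : ℂ => 2 * w) (nhds (1 / 2)) (nhds (2 * (1 / 2))) :=
        (continuous_const.mul continuous_id).tendsto _
      norm_num at this
      exact (by simpa using this : Tendsto (fun w : ℂ => 2 * w) (nhds (1 / 2)) (nhds 1)).mono_left
        nhdsWithin_le_nhds
    · filter_upwards [self_mem_nhdsWithin] with w hw h
      have h' : 2 * w = 1 := h
      exact hw (show w = 1 / 2 by linear_combination h' / 2)
  refine ((tendsto_riemannZeta_sub_one_div.comp ht).const_mul 2).congr' ?_
  have h0 : ∀ᶠ w : ℂ in nhdsWithin (1 / 2) {1 / 2}ᶜ, w ≠ 0 :=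
    nhdsWithin_le_nhds (isOpen_ne.mem_nhds (by norm_num : (1 / 2 : ℂ) ≠ 0))
  filter_upwards [self_mem_nhdsWithin, h0] with w hw hw0
  have hw1 : 2 * w - 1 ≠ 0 := fun h => hw (show w = 1 / 2 by linear_combination h / 2)
  rw [slope_def_field, zetaEntire_one_half, zetaEntire_eq hw0 hw, Function.comp_apply,
    show w - 1 / 2 = (2 * w - 1) / 2 by ring]
  field_simp

lemma deriv_perronNumerator_one_half (heven : χ.Even) (hχ : χ ≠ 1) (hρ : 1 < ρ) (hx : 0 < x) :
    deriv (perronNumerator χ ρ x) ((1 / 2 : ℝ) : ℂ) =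
      ((√π * x / (4 * Real.Gamma (ρ + 3 / 2)) : ℝ) : ℂ) *
        (2 * deriv χ.LFunction 1 + χ.LFunction 1 *
          ((deriv Real.Gamma (1 / 2) / √π - deriv Real.Gamma (ρ + 3 / 2) / Real.Gamma (ρ + 3 / 2)
            + 2 * Real.log x + 4 * Real.eulerMascheroniConstant : ℝ) : ℂ)) := by
  have hxc : (x : ℂ) ≠ 0 := by exact_mod_cast hx.ne'
  have hhalf : ((1 / 2 : ℝ) : ℂ) = 1 / 2 := by push_cast; ring
  have hG0 : Real.Gamma (ρ + 3 / 2) ≠ 0 := (Real.Gamma_pos_of_pos (by linarith)).ne'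
  have hG0' : (Real.Gamma (ρ + 3 / 2) : ℂ) ≠ 0 := by exact_mod_cast hG0
  have harg : (1 / 2 : ℂ) + ρ + 1 = ((ρ + 3 / 2 : ℝ) : ℂ) := by push_cast; ring
  have hL : HasDerivAt (fun w : ℂ => χ.LFunction (2 * w)) (deriv χ.LFunction 1 * 2) (1 / 2) := by
    refine HasDerivAt.comp (h₂ := χ.LFunction) (h := fun w : ℂ => 2 * w) (1 / 2 : ℂ) ?_ ?_
    · have := (χ.differentiable_LFunction hχ 1).hasDerivAt
      simpa using this
    · simpa using (hasDerivAt_id (1 / 2 : ℂ)).const_mul 2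
  have hΓ : HasDerivAt Complex.Gamma ((deriv Real.Gamma (1 / 2) : ℝ) : ℂ) (1 / 2) := by
    rw [← hhalf]
    exact hasDerivAt_complexGamma_ofReal (by norm_num)
  have hΓ' : HasDerivAt (fun w : ℂ => (Complex.Gamma (w + ρ + 1))⁻¹)
      (-((deriv Real.Gamma (ρ + 3 / 2) : ℝ) : ℂ) / (Real.Gamma (ρ + 3 / 2) : ℂ) ^ 2) (1 / 2) := by
    have h1 : HasDerivAt (fun w : ℂ => Complex.Gamma (w + ρ + 1))
        (((deriv Real.Gamma (ρ + 3 / 2) : ℝ) : ℂ) * 1) (1 / 2) := by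
      refine HasDerivAt.comp (h₂ := Complex.Gamma) (h := fun w : ℂ => w + ρ + 1) (1 / 2 : ℂ) ?_ ?_
      · rw [harg]
        exact hasDerivAt_complexGamma_ofReal (by linarith)
      · exact ((hasDerivAt_id _).add_const _).add_const _
    have h2 := h1.fun_inv (by rw [harg, Complex.Gamma_ofReal]; exact hG0')
    rw [harg, Complex.Gamma_ofReal, mul_one] at h2
    exact h2
  have hX : HasDerivAt (fun w : ℂ => (x : ℂ) ^ (2 * w)) (x * Real.log x * 2) (1 / 2) := by
    have h1 : HasDerivAt (fun w : ℂ => 2 * w) 2 (1 / 2) := by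
      simpa using (hasDerivAt_id (1 / 2 : ℂ)).const_mul 2
    have h2 := h1.const_cpow (c := (x : ℂ)) (Or.inl hxc)
    rw [show (2 : ℂ) * (1 / 2) = 1 by norm_num, Complex.cpow_one, ← Complex.ofReal_log hx.le] at h2
    exact h2
  have hZ := hasDerivAt_zetaEntire_one_half.fun_pow 2
  have hev : perronNumerator χ ρ x =ᶠ[nhds (1 / 2)] fun w =>
      χ.LFunction (2 * w) * Complex.Gamma w * zetaEntire w ^ 2 * (1 / 4) *
        (Complex.Gamma (w + ρ + 1))⁻¹ * (x : ℂ) ^ (2 * w) := by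
    have hπ : (π : ℂ) ≠ 0 := by exact_mod_cast Real.pi_ne_zero
    have ho : ∀ᶠ w : ℂ in nhds (1 / 2), 0 < w.re :=
      (isOpen_lt continuous_const Complex.continuous_re).mem_nhds (by norm_num)
    filter_upwards [ho] with w hw
    have hp : (π : ℂ) ^ w ≠ 0 := by simp [Complex.cpow_eq_zero_iff, hπ]
    rw [perronNumerator, completedLFunction_two_mul heven hw, Complex.cpow_neg]
    field_simp
  have hsq : (√π : ℂ) ≠ 0 := by exact_mod_cast (Real.sqrt_pos.mpr Real.pi_pos).ne'
  have hG12 : Complex.Gamma (1 / 2) = (√π : ℂ) := by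
    rw [← hhalf, Complex.Gamma_ofReal, Real.Gamma_one_half_eq]
  rw [hhalf, hev.deriv_eq,
    (((((hL.fun_mul hΓ).fun_mul hZ).mul_const (1 / 4)).fun_mul hΓ').fun_mul hX).deriv,
    zetaEntire_one_half, hG12, harg, Complex.Gamma_ofReal,
    show (2 : ℂ) * (1 / 2) = 1 by norm_num, Complex.cpow_one]
  generalize Real.Gamma (ρ + 3 / 2) = g at hG0'
  generalize deriv Real.Gamma (ρ + 3 / 2) = g'
  push_cast
  field_simp
  ring

theorem norm_sum_sub_deriv_perronNumerator_le (hN : 1 < N) (heven : χ.Even) (hχ : χ ≠ 1)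
    (hprim : χ.IsPrimitive) (hinv : χ⁻¹ = χ) (hρ : 1 < ρ) : ∃ B X₁ : ℝ, 1 ≤ X₁ ∧ ∀ x, X₁ ≤ x →
    ‖2 * π * ∑ n ∈ Finset.Icc 1 ⌊x⌋₊,
        scrD χ n * (((1 - ((n : ℝ) / x) ^ 2) ^ ρ / Real.Gamma (ρ + 1) : ℝ) : ℂ) -
      2 * π * deriv (perronNumerator χ ρ x) ((1 / 2 : ℝ) : ℂ)‖ ≤ B * x ^ ((1 - ρ) / 3) := by
  obtain ⟨B, X₁, hX₁, hB⟩ :=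
    exists_norm_integral_perronNumerator_dual_le heven hprim hinv hρ
  refine ⟨B, X₁, hX₁, fun x hx => ?_⟩
  have hx0 : 0 < x := by linarith
  have h := norm_integral_vertical_sub_le (differentiable_perronNumerator hχ ρ hx0)
    (expBoundedOnStrips_perronNumerator hN.ne' heven hχ ρ hx0) (σ₀ := 1 / 8 - ρ / 6) (σ₁ := 1)
    (p := 1 / 2) (by linarith) (by norm_num)
    (by simpa using integrable_perronNumerator_line_one hρ hχ heven hx0) (hB x hx)
  rw [Complex.ofReal_one, integral_perronNumerator_line_one hρ heven hx0] at h
  exact h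

end PerronIntegral

theorem statement10 (N : ℕ) [NeZero N] (hN : 1 < N) (χ₁ : DirichletCharacter ℂ N)
    (hreal : ∀ a : ZMod N, (χ₁ a).im = 0) (heven : χ₁.Even) (hnp : χ₁ ≠ 1)
    (hprim : χ₁.IsPrimitive) (ρ : ℝ) (hρ : 1 < ρ) :
    (fun x : ℝ =>
        (1 / (Real.Gamma (ρ + 1) : ℂ)) *
            ∑ n ∈ Finset.Icc 1 ⌊x⌋₊, (((x ^ 2 - (n : ℝ) ^ 2) ^ ρ : ℝ) : ℂ) * scrD χ₁ n
          - ((Real.sqrt π * x ^ (1 + 2 * ρ) / (4 * Real.Gamma (ρ + 3 / 2)) : ℝ) : ℂ) *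
              (2 * deriv (DirichletCharacter.LFunction χ₁) 1 +
                DirichletCharacter.LFunction χ₁ 1 *
                  ((deriv Real.Gamma (1 / 2) / Real.sqrt π
                      - deriv Real.Gamma (ρ + 3 / 2) / Real.Gamma (ρ + 3 / 2)
                      + 2 * Real.log x + 4 * Real.eulerMascheroniConstant : ℝ) : ℂ)))
      =O[atTop] fun x : ℝ => x ^ ((5 * ρ + 1) / 3) := by
  obtain ⟨B, X₁, hX₁, hB⟩ := norm_sum_sub_deriv_perronNumerator_le hN heven hnp hprim
    (inv_eq_self_of_im_eq_zero hreal) hρ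
  refine IsBigO.of_bound (B / (2 * π)) ?_
  filter_upwards [eventually_ge_atTop X₁] with x hx
  have hx0 : 0 < x := by linarith
  have hπ : (0 : ℝ) < 2 * π := by positivity
  have h := hB x hx
  rw [deriv_perronNumerator_one_half heven hnp hρ hx0, ← mul_sub, norm_mul,
    show ‖(2 * π : ℂ)‖ = 2 * π by
      rw [show (2 * π : ℂ) = ((2 * π : ℝ) : ℂ) by push_cast; ring, Complex.norm_real,
        Real.norm_of_nonneg hπ.le], ← le_div_iff₀' hπ] at h
  rw [Real.norm_of_nonneg (by positivity)]
  set D : ℂ := 2 * deriv χ₁.LFunction 1 + χ₁.LFunction 1 *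
    ((deriv Real.Gamma (1 / 2) / √π - deriv Real.Gamma (ρ + 3 / 2) / Real.Gamma (ρ + 3 / 2)
      + 2 * Real.log x + 4 * Real.eulerMascheroniConstant : ℝ) : ℂ)
  have hsum : (1 / (Real.Gamma (ρ + 1) : ℂ)) *
      ∑ n ∈ Finset.Icc 1 ⌊x⌋₊, (((x ^ 2 - (n : ℝ) ^ 2) ^ ρ : ℝ) : ℂ) * scrD χ₁ n =
      ((x ^ (2 * ρ) : ℝ) : ℂ) * ∑ n ∈ Finset.Icc 1 ⌊x⌋₊,
        scrD χ₁ n * (((1 - ((n : ℝ) / x) ^ 2) ^ ρ / Real.Gamma (ρ + 1) : ℝ) : ℂ) := by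
    rw [Finset.mul_sum, Finset.mul_sum]
    refine Finset.sum_congr rfl fun n hn => ?_
    have hnx : (n : ℝ) ≤ x := (Nat.le_floor_iff hx0.le).mp (Finset.mem_Icc.mp hn).2
    have h1 : (n : ℝ) / x ≤ 1 := (div_le_one hx0).mpr hnx
    have h0 : 0 ≤ (n : ℝ) / x := by positivity
    have h2 : (x ^ 2 - (n : ℝ) ^ 2) ^ ρ = x ^ (2 * ρ) * (1 - ((n : ℝ) / x) ^ 2) ^ ρ := by
      rw [show x ^ 2 - (n : ℝ) ^ 2 = x ^ 2 * (1 - ((n : ℝ) / x) ^ 2) by field_simp,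
        Real.mul_rpow (by positivity) (by nlinarith), ← Real.rpow_natCast x 2,
        ← Real.rpow_mul hx0.le]
      norm_num
    rw [h2, Complex.ofReal_div, Complex.ofReal_mul]
    ring
  have hmain : ((√π * x ^ (1 + 2 * ρ) / (4 * Real.Gamma (ρ + 3 / 2)) : ℝ) : ℂ) =
      ((x ^ (2 * ρ) : ℝ) : ℂ) * ((√π * x / (4 * Real.Gamma (ρ + 3 / 2)) : ℝ) : ℂ) := by
    rw [Real.rpow_add hx0, Real.rpow_one, ← Complex.ofReal_mul]
    congr 1
    ring
  rw [hsum, hmain, mul_assoc, ← mul_sub, norm_mul, Complex.norm_real,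
    Real.norm_of_nonneg (by positivity)]
  calc _ ≤ x ^ (2 * ρ) * (B * x ^ ((1 - ρ) / 3) / (2 * π)) := by gcongr
    _ = B / (2 * π) * (x ^ (2 * ρ) * x ^ ((1 - ρ) / 3)) := by ring
    _ = B / (2 * π) * x ^ ((5 * ρ + 1) / 3) := by
      rw [← Real.rpow_add hx0]
      congr 2
      ring
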